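/- Let n ≥ 2 and 1 < p < 2. Then liminf_{δ→0} (d_p(δ) − 1)/δ^{p/(n−1+p)} ≥ c₁, where c₁ = ((n−1+p)^{p/(n−1+p)}/p)·(|B_p^n|ₙ/|B_p^{n−1}|_{n−1})^{p/(n−1+p)}. -/

import Mathlib

open MeasureTheory Metric Set Filter
open scoped RealInnerProductSpace Pointwise Topology

noncomputable section

abbrev Euc (n : ℕ) : Type := EuclideanSpace ℝ (Fin n)

/-- A centrally symmetric convex body in `ℝⁿ`. -/
def IsSymConvexBody {n : ℕ} (S : Set (Euc n)) : Prop :=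
  IsCompact S ∧ Convex ℝ S ∧ (interior S).Nonempty ∧ S = -S

/-- The convex floating body `K_δ`: the intersection of all closed halfspaces whose bounding
hyperplane cuts off a set of volume at most `δ·|K|ₙ` from `K`. -/
def floatingBody {n : ℕ} (K : Set (Euc n)) (δ : ℝ) : Set (Euc n) :=
  ⋂ (v : Euc n) (_ : v ≠ 0) (c : ℝ)
    (_ : volume (K ∩ {y | c ≤ ⟪v, y⟫}) ≤ ENNReal.ofReal δ * volume K),
    {y | ⟪v, y⟫ ≤ c}

/-- The illumination body `K^δ`. -/
def illuminationBody {n : ℕ} (K : Set (Euc n)) (δ : ℝ) : Set (Euc n) :=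
  {x | volume (convexHull ℝ (K ∪ {x})) ≤ ENNReal.ofReal (1 + δ) * volume K}

/-- The polar body `K°`. -/
def polarBody {n : ℕ} (K : Set (Euc n)) : Set (Euc n) :=
  {y | ∀ x ∈ K, ⟪x, y⟫ ≤ 1}

/-- The distance `d(C₁, C₂) = inf {a ≥ 1 : a⁻¹ C₁ ⊆ C₂ ⊆ a C₁}`. -/
def bodyDist {n : ℕ} (C₁ C₂ : Set (Euc n)) : ℝ :=
  sInf {a : ℝ | 1 ≤ a ∧ a⁻¹ • C₁ ⊆ C₂ ∧ C₂ ⊆ a • C₁}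

/-- `d_C(δ) = inf_{δ' > 0} d(C_δ, ((C°)^{δ'})°)`. -/
def dualDist {n : ℕ} (C : Set (Euc n)) (δ : ℝ) : ℝ :=
  sInf {r : ℝ | ∃ δ' > (0:ℝ), r = bodyDist (floatingBody C δ)
      (polarBody (illuminationBody (polarBody C) δ'))}

/-- `ν` is an outer unit normal of `S` at `x`. -/
def IsOuterNormalAt {n : ℕ} (S : Set (Euc n)) (x ν : Euc n) : Prop :=
  ‖ν‖ = 1 ∧ ∀ y ∈ S, ⟪y, ν⟫ ≤ ⟪x, ν⟫

/-- Near `x ∈ ∂S`, the boundary of `S` is the graph of a `C²` function `f` over the tangent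
hyperplane at `x` (embedded via a linear isometry `L` orthogonal to the normal `ν`), with
`f 0 = 0` and vanishing derivative at `0`, and `k` is the determinant of the Hessian of `f`
at `0`, i.e. the Gauss curvature of `∂S` at `x`. -/
def IsGaussCurvatureAt {n : ℕ} (S : Set (Euc n)) (x ν : Euc n) (k : ℝ) : Prop :=
  ∃ (L : Euc (n-1) →ₗᵢ[ℝ] Euc n) (f : Euc (n-1) → ℝ) (τ ε : ℝ),
    0 < τ ∧ 0 < ε ∧
    (∀ v, ⟪L v, ν⟫ = 0) ∧
    ContDiffOn ℝ 2 f (ball 0 τ) ∧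
    f 0 = 0 ∧ fderiv ℝ f 0 = 0 ∧
    frontier S ∩ ball x ε
      = {y | ∃ v ∈ ball (0 : Euc (n-1)) τ, y = x + L v - f v • ν} ∩ ball x ε ∧
    k = (Matrix.of fun i j : Fin (n-1) =>
      iteratedFDeriv ℝ 2 f 0 ![EuclideanSpace.single i 1, EuclideanSpace.single j 1]).det

/-- `S` has `C²` boundary, with outer unit normal map `u` and Gauss curvature function `κ`. -/
def IsC2Body {n : ℕ} (S : Set (Euc n)) (u : Euc n → Euc n) (κ : Euc n → ℝ) : Prop :=
  ∀ x ∈ frontier S, IsOuterNormalAt S x (u x) ∧ IsGaussCurvatureAt S x (u x) (κ x)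

/-- The constant `c(K, n) = ((n+1)^{2/(n+1)}/2)·(|K|ₙ/|B₂^{n−1}|_{n−1})^{2/(n+1)}`. -/
def cConst (n : ℕ) (K : Set (Euc n)) : ℝ :=
  ((n + 1 : ℝ) ^ ((2:ℝ)/(n+1)) / 2) *
    ((volume K).toReal / (volume (ball (0 : Euc (n-1)) 1)).toReal) ^ ((2:ℝ)/(n+1))

/-- The function `G_S(x) = c(S,n)·κ(x)^{1/(n+1)} / ⟨x, u(x)⟩`. -/
def Gfun {n : ℕ} (S : Set (Euc n)) (u : Euc n → Euc n) (κ : Euc n → ℝ) (x : Euc n) : ℝ :=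
  cConst n S * (κ x) ^ ((1:ℝ)/(n+1)) / ⟪x, u x⟫

/-- The unit ball of `ℓ_p^n`. -/
def lpBall (n : ℕ) (p : ℝ) : Set (Euc n) :=
  {x | (∑ i, |x i| ^ p) ≤ 1}

/-- The signed power `|s|^(r-2) s`, i.e. the derivative of `|s|^r / r`. -/
def signedPow (r s : ℝ) : ℝ := |s| ^ (r - 2) * s

lemma abs_signedPow {r : ℝ} (hr : 1 < r) (s : ℝ) : |signedPow r s| = |s| ^ (r - 1) := by
  unfold signedPow
  rcases eq_or_ne s 0 with rfl | hs
  · simp [Real.zero_rpow (by linarith : r - 1 ≠ 0)]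
  · have h : 0 < |s| := abs_pos.mpr hs
    rw [abs_mul, abs_of_nonneg (Real.rpow_nonneg h.le _), ← Real.rpow_add_one h.ne']
    ring_nf

lemma signedPow_mul_self {r : ℝ} (hr : 1 < r) (s : ℝ) : signedPow r s * s = |s| ^ r := by
  unfold signedPow
  rcases eq_or_ne s 0 with rfl | hs
  · simp [Real.zero_rpow (by linarith : r ≠ 0)]
  · have h : 0 < |s| := abs_pos.mpr hs
    rw [mul_assoc, ← abs_mul_abs_self s, ← mul_assoc, ← Real.rpow_add_one h.ne',
      ← Real.rpow_add_one h.ne']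
    ring_nf

lemma signedPow_of_nonneg {r s : ℝ} (hr : 1 < r) (hs : 0 ≤ s) :
    signedPow r s = s ^ (r - 1) := by
  have h := abs_signedPow hr s
  rwa [abs_of_nonneg (by unfold signedPow; positivity), abs_of_nonneg hs] at h

lemma signedPow_neg (r s : ℝ) : signedPow r (-s) = -signedPow r s := by
  simp [signedPow]

lemma signedPow_signedPow {p q : ℝ} (h : p.HolderConjugate q) (s : ℝ) :
    signedPow p (signedPow q s) = s := by
  rcases eq_or_ne s 0 with rfl | hs
  · simp [signedPow]
  · have h0 : 0 < |s| := abs_pos.mpr hs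
    have e : signedPow p (signedPow q s) = |signedPow q s| ^ (p - 2) * signedPow q s := rfl
    rw [e, abs_signedPow h.symm.lt, signedPow, ← mul_assoc, ← Real.rpow_mul h0.le,
      ← Real.rpow_add h0]
    have : (q - 1) * (p - 2) + (q - 2) = 0 := by
      have := h.mul_eq_add
      linarith
    rw [this]; simp

lemma abs_signedPow_rpow {p q : ℝ} (h : p.HolderConjugate q) (s : ℝ) :
    |signedPow q s| ^ p = |s| ^ q := by
  rw [abs_signedPow h.symm.lt, ← Real.rpow_mul (abs_nonneg s)]
  congr 1
  have := h.mul_eq_add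
  linarith

/-- Young's inequality for the signed power. -/
lemma signedPow_mul_le {r : ℝ} (hr : 1 < r) (b a : ℝ) :
    signedPow r b * a ≤ (1 - 1 / r) * |b| ^ r + (1 / r) * |a| ^ r := by
  have hc : r.HolderConjugate (r / (r - 1)) := Real.HolderConjugate.conjExponent hr
  have h1 : signedPow r b * a ≤ |a| * |b| ^ (r - 1) := by
    calc signedPow r b * a ≤ |signedPow r b * a| := le_abs_self _
      _ = |a| * |b| ^ (r - 1) := by rw [abs_mul, abs_signedPow hr, mul_comm]
  have h2 := Real.young_inequality_of_nonneg (abs_nonneg a)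
    (Real.rpow_nonneg (abs_nonneg b) (r - 1)) hc
  have hr1 : r - 1 ≠ 0 := by linarith
  rw [← Real.rpow_mul (abs_nonneg b), mul_div_cancel₀ _ hr1] at h2
  have hr0 : r ≠ 0 := by linarith
  calc _ ≤ _ := h1.trans h2
    _ = _ := by field_simp; ring

/-- The tangent line inequality for `|·|^r`. -/
lemma abs_rpow_tangent_le {r : ℝ} (hr : 1 < r) (b a : ℝ) :
    |b| ^ r + r * (signedPow r b * (a - b)) ≤ |a| ^ r := by
  have h := signedPow_mul_le hr b a
  have h2 := signedPow_mul_self hr b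
  have hr0 : 0 < r := by linarith
  have h3 := mul_le_mul_of_nonneg_left h hr0.le
  have e : r * ((1 - 1 / r) * |b| ^ r + (1 / r) * |a| ^ r) = (r - 1) * |b| ^ r + |a| ^ r := by
    field_simp
  rw [e] at h3
  rw [mul_sub, h2]
  linarith

lemma rpow_tangent_le {r a b : ℝ} (hr : 1 < r) (hb : 0 ≤ b) (ha : 0 ≤ a) :
    b ^ r + r * (b ^ (r - 1) * (a - b)) ≤ a ^ r := by
  have h := abs_rpow_tangent_le hr b a
  rwa [signedPow_of_nonneg hr hb, abs_of_nonneg ha, abs_of_nonneg hb] at h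

/-- A quadratic deficit in Young's inequality for exponents larger than two. -/
lemma exists_young_deficit {q : ℝ} (hq : 2 < q) :
    ∃ c : ℝ, 0 < c ∧ ∀ s : ℝ,
      c * (s - 1) ^ 2 ≤ 1 / q + (1 - 1 / q) * |s| ^ q - signedPow q s := by
  have hq0 : 0 < q := by linarith
  have hd : (1 / 2 : ℝ) ^ (q - 1) < 1 / q := by
    have h := one_add_mul_self_lt_rpow_one_add (s := 1) (by norm_num) one_ne_zero
      (p := q - 1) (by linarith)
    rw [one_div, Real.inv_rpow (by norm_num), one_div]
    apply inv_strictAnti₀ hq0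
    norm_num at h
    exact h
  set d := 1 / q - (1 / 2 : ℝ) ^ (q - 1) with hd'
  have hd0 : 0 < d := by linarith
  set e := (1 / 2 : ℝ) * (1 / 2) ^ (q - 2) with he
  have he0 : 0 < e := by positivity
  refine ⟨min e (d / 3), by positivity, fun s => ?_⟩
  rcases le_total (1 / 2) |s| with hs | hs
  · have h := rpow_tangent_le (r := q / 2) (by linarith) (sq_nonneg s) (sq_nonneg (1:ℝ))
    have e1 : (s ^ 2) ^ (q / 2) = |s| ^ q := by
      rw [← sq_abs, ← Real.rpow_natCast, ← Real.rpow_mul (abs_nonneg s)]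
      congr 1; push_cast; ring
    have e2 : (s ^ 2) ^ (q / 2 - 1) = |s| ^ (q - 2) := by
      rw [← sq_abs, ← Real.rpow_natCast, ← Real.rpow_mul (abs_nonneg s)]
      congr 1; push_cast; ring
    rw [e1, e2] at h
    simp only [one_pow, Real.one_rpow] at h
    have h3 := signedPow_mul_self (by linarith : 1 < q) s
    have h4 : (1 / 2 : ℝ) ^ (q - 2) ≤ |s| ^ (q - 2) :=
      Real.rpow_le_rpow (by norm_num) hs (by linarith)
    have h5 : min e (d / 3) * (s - 1) ^ 2 ≤ e * (s - 1) ^ 2 :=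
      mul_le_mul_of_nonneg_right (min_le_left _ _) (sq_nonneg _)
    refine h5.trans ?_
    have h6 : e * (s - 1) ^ 2 ≤ 1 / 2 * |s| ^ (q - 2) * (s - 1) ^ 2 := by
      rw [he]; gcongr
    refine h6.trans ?_
    have h7 : |s| ^ q + q / 2 * (|s| ^ (q - 2) * (s - 1) ^ 2)
        + q * (signedPow q s - |s| ^ q) ≤ 1 := by
      rw [← h3] at h ⊢
      have : signedPow q s = |s| ^ (q - 2) * s := rfl
      rw [this] at h ⊢
      nlinarith [h]
    have h8 : 1 / q + (1 - 1 / q) * |s| ^ q - signedPow q s - 1 / 2 * |s| ^ (q - 2) * (s - 1) ^ 2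
        = (1 / q) * (1 - (|s| ^ q + q / 2 * (|s| ^ (q - 2) * (s - 1) ^ 2)
        + q * (signedPow q s - |s| ^ q))) := by
      field_simp; ring
    have h9 : 0 ≤ (1 / q) * (1 - (|s| ^ q + q / 2 * (|s| ^ (q - 2) * (s - 1) ^ 2)
        + q * (signedPow q s - |s| ^ q))) := mul_nonneg (by positivity) (by linarith)
    linarith
  · have h1 : signedPow q s ≤ (1 / 2) ^ (q - 1) := by
      calc signedPow q s ≤ |signedPow q s| := le_abs_self _
        _ = |s| ^ (q - 1) := abs_signedPow (by linarith) s
        _ ≤ _ := Real.rpow_le_rpow (abs_nonneg _) hs (by linarith)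
    have h2 : 0 ≤ (1 - 1 / q) * |s| ^ q := by
      have : 1 / q ≤ 1 := by rw [div_le_one hq0]; linarith
      exact mul_nonneg (by linarith) (by positivity)
    have h3 : (s - 1) ^ 2 ≤ 3 := by
      have := abs_le.mp hs
      nlinarith
    have h4 : min e (d / 3) * (s - 1) ^ 2 ≤ d / 3 * 3 :=
      mul_le_mul (min_le_right _ _) h3 (sq_nonneg _) (by positivity)
    linarith

/-- A second-order upper bound for `s^q` near `1`. -/
lemma rpow_le_one_add_sq {q s : ℝ} (hq : 2 < q) (hs : |s - 1| ≤ 1) :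
    |s| ^ q ≤ 1 + q * (s - 1) + q * ((q - 1) * 2 ^ (q - 2)) * (s - 1) ^ 2 := by
  obtain ⟨hs1, hs2⟩ := abs_le.mp hs
  have hs0 : 0 ≤ s := by linarith
  rw [abs_of_nonneg hs0]
  have h1 := rpow_tangent_le (r := q) (by linarith) hs0 zero_le_one
  have h2 := rpow_tangent_le (r := q - 1) (by linarith) hs0 zero_le_one
  have h3 := rpow_tangent_le (r := q - 1) (by linarith) zero_le_one hs0
  simp only [Real.one_rpow, one_mul] at h1 h2 h3
  have e : q - 1 - 1 = q - 2 := by ring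
  rw [e] at h2
  have h4 : s ^ (q - 2) ≤ 2 ^ (q - 2) := Real.rpow_le_rpow hs0 (by linarith) (by linarith)
  have h5 : (1 : ℝ) ≤ 2 ^ (q - 2) := Real.one_le_rpow (by norm_num) (by linarith)
  have h6 : 0 ≤ s ^ (q - 2) := by positivity
  have hq1 : 0 < q - 1 := by linarith
  have key : (s ^ (q - 1) - 1) * (s - 1) ≤ (q - 1) * 2 ^ (q - 2) * (s - 1) ^ 2 := by
    rcases le_total 1 s with h | h
    · have h7 : s ^ (q - 1) - 1 ≤ (q - 1) * 2 ^ (q - 2) * (s - 1) := by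
        have : (q - 1) * (s ^ (q - 2) * (s - 1)) ≤ (q - 1) * (2 ^ (q - 2) * (s - 1)) := by
          gcongr
        nlinarith
      nlinarith [mul_le_mul_of_nonneg_right h7 (by linarith : 0 ≤ s - 1)]
    · have h7 : 1 - s ^ (q - 1) ≤ (q - 1) * 2 ^ (q - 2) * (1 - s) := by
        have : (q - 1) * (1 * (1 - s)) ≤ (q - 1) * (2 ^ (q - 2) * (1 - s)) := by
          gcongr
        nlinarith
      nlinarith [mul_le_mul_of_nonneg_right h7 (by linarith : 0 ≤ 1 - s)]
  nlinarith [mul_le_mul_of_nonneg_left key (by linarith : 0 ≤ q)]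

lemma abs_rpow_sub_rpow_le {r a b : ℝ} (h0 : 0 < r) (h1 : r ≤ 1) (ha : 0 ≤ a) (hb : 0 ≤ b) :
    |a ^ r - b ^ r| ≤ |a - b| ^ r := by
  wlog h : b ≤ a generalizing a b
  · rw [abs_sub_comm, abs_sub_comm a]
    exact this hb ha (le_of_not_ge h)
  have h2 := Real.rpow_add_le_add_rpow (sub_nonneg.mpr h) hb h0.le h1
  rw [sub_add_cancel] at h2
  rw [abs_of_nonneg (sub_nonneg.mpr (Real.rpow_le_rpow hb h h0.le)),
    abs_of_nonneg (sub_nonneg.mpr h)]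
  linarith

/-- For `1 < p < 2` the signed power is Hölder continuous of exponent `p - 1`. -/
lemma abs_signedPow_sub_le {p : ℝ} (hp1 : 1 < p) (hp2 : p < 2) (a b : ℝ) :
    |signedPow p a - signedPow p b| ≤ 2 * |a - b| ^ (p - 1) := by
  wlog ha : 0 ≤ a generalizing a b
  · have h := this (-a) (-b) (by linarith)
    rw [signedPow_neg, signedPow_neg] at h
    have e1 : -signedPow p a - -signedPow p b = -(signedPow p a - signedPow p b) := by ring
    have e2 : -a - -b = -(a - b) := by ring
    rwa [e1, e2, abs_neg, abs_neg] at h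
  have hx : 0 ≤ |a - b| ^ (p - 1) := by positivity
  rcases le_total 0 b with hb | hb
  · rw [signedPow_of_nonneg hp1 ha, signedPow_of_nonneg hp1 hb]
    have := abs_rpow_sub_rpow_le (by linarith : 0 < p - 1) (by linarith) ha hb
    linarith
  · have hb' : b = -(-b) := by ring
    rw [hb', signedPow_neg, signedPow_of_nonneg hp1 ha,
      signedPow_of_nonneg hp1 (by linarith : 0 ≤ -b)]
    have h1 : a ^ (p - 1) ≤ |a - -(-b)| ^ (p - 1) :=
      Real.rpow_le_rpow ha (by rw [abs_of_nonneg (by linarith)]; linarith) (by linarith)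
    have h2 : (-b) ^ (p - 1) ≤ |a - -(-b)| ^ (p - 1) :=
      Real.rpow_le_rpow (by linarith) (by rw [abs_of_nonneg (by linarith)]; linarith) (by linarith)
    have h3 : 0 ≤ (-b) ^ (p - 1) := Real.rpow_nonneg (by linarith) _
    have h4 : 0 ≤ a ^ (p - 1) := Real.rpow_nonneg ha _
    rw [sub_neg_eq_add, abs_of_nonneg (by linarith)]
    linarith

/-- Uniform smoothness of order `p` of `|·|^p` for `1 < p < 2`. -/
lemma abs_add_rpow_le {p : ℝ} (hp1 : 1 < p) (hp2 : p < 2) (x z : ℝ) :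
    |x + z| ^ p ≤ |x| ^ p + p * (signedPow p x * z) + 2 * p * |z| ^ p := by
  have h1 := abs_rpow_tangent_le hp1 (x + z) x
  have h2 := abs_signedPow_sub_le hp1 hp2 (x + z) x
  rw [add_sub_cancel_left] at h2
  have h3 : (signedPow p (x + z) - signedPow p x) * z ≤ 2 * |z| ^ p := by
    calc _ ≤ |(signedPow p (x + z) - signedPow p x) * z| := le_abs_self _
      _ = |signedPow p (x + z) - signedPow p x| * |z| := abs_mul _ _
      _ ≤ 2 * |z| ^ (p - 1) * |z| := by gcongr
      _ = 2 * |z| ^ p := by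
        rcases eq_or_ne z 0 with rfl | hz
        · simp [Real.zero_rpow (by linarith : p ≠ 0)]
        · rw [mul_assoc, ← Real.rpow_add_one (abs_pos.mpr hz).ne', sub_add_cancel]
  have h4 := mul_le_mul_of_nonneg_left h3 (by linarith : 0 ≤ p)
  nlinarith

lemma inner_eq_sum {n : ℕ} (x y : Euc n) : ⟪x, y⟫ = ∑ i, x i * y i := by
  rw [PiLp.inner_apply]
  exact Finset.sum_congr rfl fun i _ => by simp [mul_comm]

lemma continuous_sum_rpow {n : ℕ} {p : ℝ} (hp : 0 ≤ p) :
    Continuous fun x : Euc n => ∑ i, |x i| ^ p :=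
  continuous_finsetSum _ fun i _ =>
    Continuous.rpow_const (by fun_prop) fun _ => Or.inr hp

lemma isClosed_lpBall {n : ℕ} {p : ℝ} (hp : 0 ≤ p) : IsClosed (lpBall n p) :=
  isClosed_le (continuous_sum_rpow hp) continuous_const

lemma abs_le_one_of_mem_lpBall {n : ℕ} {p : ℝ} (hp : 0 < p) {x : Euc n} (hx : x ∈ lpBall n p)
    (i : Fin n) : |x i| ≤ 1 := by
  have h : |x i| ^ p ≤ ∑ j, |x j| ^ p :=
    Finset.single_le_sum (f := fun j => |x j| ^ p) (fun j _ => by positivity) (Finset.mem_univ i)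
  by_contra! hc
  have := Real.one_lt_rpow hc hp
  have hx' : ∑ j, |x j| ^ p ≤ 1 := hx
  linarith

lemma isBounded_lpBall {n : ℕ} {p : ℝ} (hp : 0 < p) : Bornology.IsBounded (lpBall n p) := by
  refine (isBounded_iff_forall_norm_le).mpr ⟨√n, fun x hx => ?_⟩
  rw [EuclideanSpace.norm_eq]
  apply Real.sqrt_le_sqrt
  calc ∑ i, ‖x i‖ ^ 2 ≤ ∑ _i : Fin n, (1 : ℝ) := by
        refine Finset.sum_le_sum fun i _ => ?_
        rw [Real.norm_eq_abs]
        exact pow_le_one₀ (abs_nonneg _) (abs_le_one_of_mem_lpBall hp hx i)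
    _ = n := by simp

lemma volume_lpBall_ne_top {n : ℕ} {p : ℝ} (hp : 0 < p) : volume (lpBall n p) ≠ ⊤ :=
  (isBounded_lpBall hp).measure_lt_top.ne

lemma volume_lpBall_pos {n : ℕ} {p : ℝ} (hp : 0 < p) : 0 < volume (lpBall n p) := by
  have hopen : IsOpen {x : Euc n | ∑ i, |x i| ^ p < 1} :=
    isOpen_lt (continuous_sum_rpow hp.le) continuous_const
  refine lt_of_lt_of_le (hopen.measure_pos volume ⟨0, ?_⟩) (measure_mono fun x hx => ?_)
  · simp [Real.zero_rpow hp.ne']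
  · have hx' : ∑ i, |x i| ^ p < 1 := hx
    exact hx'.le

lemma neg_mem_lpBall {n : ℕ} {p : ℝ} {x : Euc n} (hx : x ∈ lpBall n p) : -x ∈ lpBall n p := by
  simpa [lpBall] using hx

lemma zero_mem_lpBall {n : ℕ} {p : ℝ} (hp : 0 < p) : (0 : Euc n) ∈ lpBall n p := by
  simp [lpBall, Real.zero_rpow hp.ne']

lemma convex_lpBall {n : ℕ} {p : ℝ} (hp : 1 < p) : Convex ℝ (lpBall n p) := by
  intro x hx y hy a b ha hb hab
  have hx' : ∑ j, |x j| ^ p ≤ 1 := hx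
  have hy' : ∑ j, |y j| ^ p ≤ 1 := hy
  change ∑ i, |(a • x + b • y) i| ^ p ≤ 1
  have h : ∀ i, |(a • x + b • y) i| ^ p ≤ a * |x i| ^ p + b * |y i| ^ p := by
    intro i
    have e : (a • x + b • y) i = a * x i + b * y i := by simp
    rw [e]
    have h1 := mul_le_mul_of_nonneg_left (abs_rpow_tangent_le hp (a * x i + b * y i) (x i)) ha
    have h2 := mul_le_mul_of_nonneg_left (abs_rpow_tangent_le hp (a * x i + b * y i) (y i)) hb
    have hb' : b = 1 - a := by linarith
    subst hb'
    nlinarith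
  calc _ ≤ ∑ i, (a * |x i| ^ p + b * |y i| ^ p) := Finset.sum_le_sum fun i _ => h i
    _ = a * ∑ i, |x i| ^ p + b * ∑ i, |y i| ^ p := by
        rw [Finset.sum_add_distrib, Finset.mul_sum, Finset.mul_sum]
    _ ≤ a * 1 + b * 1 := by gcongr
    _ = 1 := by linarith

/-- The coordinatewise signed power. -/
def dualVec {n : ℕ} (r : ℝ) (x : Euc n) : Euc n := WithLp.toLp 2 fun i => signedPow r (x i)

@[simp] lemma dualVec_apply {n : ℕ} (r : ℝ) (x : Euc n) (i : Fin n) :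
    dualVec r x i = signedPow r (x i) := rfl

lemma inner_dualVec_self {n : ℕ} {r : ℝ} (hr : 1 < r) (x : Euc n) :
    ⟪dualVec r x, x⟫ = ∑ i, |x i| ^ r := by
  rw [inner_eq_sum]
  exact Finset.sum_congr rfl fun i _ => signedPow_mul_self hr _

lemma inner_dualVec_le {n : ℕ} {r : ℝ} (hr : 1 < r) (x y : Euc n) :
    ⟪dualVec r x, y⟫ ≤ (1 - 1 / r) * ∑ i, |x i| ^ r + 1 / r * ∑ i, |y i| ^ r := by
  rw [inner_eq_sum, Finset.mul_sum, Finset.mul_sum, ← Finset.sum_add_distrib]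
  exact Finset.sum_le_sum fun i _ => signedPow_mul_le hr _ _

lemma dualVec_dualVec {n : ℕ} {p q : ℝ} (h : p.HolderConjugate q) (x : Euc n) :
    dualVec p (dualVec q x) = x := by
  ext i; exact signedPow_signedPow h _

lemma sum_dualVec_rpow {n : ℕ} {p q : ℝ} (h : p.HolderConjugate q) (x : Euc n) :
    ∑ i, |dualVec q x i| ^ p = ∑ i, |x i| ^ q :=
  Finset.sum_congr rfl fun _ _ => abs_signedPow_rpow h _

/-- Every nonzero vector is a positive multiple of a point of the `ℓ_q` unit sphere. -/
lemma exists_normalize {n : ℕ} {q : ℝ} (hq : 0 < q) {v : Euc n} (hv : v ≠ 0) :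
    ∃ (H : ℝ) (w : Euc n), 0 < H ∧ v = H • w ∧ ∑ i, |w i| ^ q = 1 ∧
      H ^ q = ∑ i, |v i| ^ q := by
  set S := ∑ i, |v i| ^ q with hS
  have hS0 : 0 < S := by
    obtain ⟨i, hi⟩ : ∃ i, v i ≠ 0 := by
      by_contra! h
      exact hv (by ext i; simpa using h i)
    exact Finset.sum_pos' (fun j _ => by positivity)
      ⟨i, Finset.mem_univ _, Real.rpow_pos_of_pos (abs_pos.mpr hi) _⟩
  have hH : (S ^ (1 / q)) ^ q = S := by
    rw [← Real.rpow_mul hS0.le]; field_simp; simp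
  have hH0 : 0 < S ^ (1 / q) := Real.rpow_pos_of_pos hS0 _
  refine ⟨S ^ (1 / q), (S ^ (1 / q))⁻¹ • v, hH0, ?_, ?_, hH⟩
  · rw [smul_inv_smul₀ hH0.ne']
  · have : ∀ i, |((S ^ (1 / q))⁻¹ • v) i| ^ q = S⁻¹ * |v i| ^ q := by
      intro i
      rw [PiLp.smul_apply, smul_eq_mul, abs_mul, Real.mul_rpow (abs_nonneg _) (abs_nonneg _),
        abs_of_pos (inv_pos.mpr hH0), Real.inv_rpow hH0.le, hH]
    rw [Finset.sum_congr rfl fun i _ => this i, ← Finset.mul_sum, ← hS]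
    exact inv_mul_cancel₀ hS0.ne'

lemma inner_le_one {n : ℕ} {p q : ℝ} (h : p.HolderConjugate q) {x y : Euc n}
    (hx : x ∈ lpBall n p) (hy : y ∈ lpBall n q) : ⟪x, y⟫ ≤ 1 := by
  have h1 := inner_dualVec_le h.symm.lt (dualVec p x) y
  rw [dualVec_dualVec h.symm, sum_dualVec_rpow h.symm] at h1
  have hx' : ∑ j, |x j| ^ p ≤ 1 := hx
  have hy' : ∑ j, |y j| ^ q ≤ 1 := hy
  have hq : 0 < 1 / q := one_div_pos.mpr h.symm.pos
  have hq1 : 1 / q ≤ 1 := by rw [div_le_one h.symm.pos]; exact h.symm.lt.le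
  nlinarith

lemma polarBody_lpBall {n : ℕ} {p q : ℝ} (h : p.HolderConjugate q) :
    polarBody (lpBall n p) = lpBall n q := by
  ext y
  refine ⟨fun hy => ?_, fun hy x hx => inner_le_one h hx hy⟩
  rcases eq_or_ne y 0 with rfl | hy0
  · exact zero_mem_lpBall h.symm.pos
  obtain ⟨H, w, hH, hv, hw, hHq⟩ := exists_normalize h.symm.pos hy0
  have h1 : dualVec q w ∈ lpBall n p := by
    change ∑ i, |dualVec q w i| ^ p ≤ 1
    rw [sum_dualVec_rpow h, hw]
  have h2 := hy _ h1
  rw [hv, inner_smul_right, inner_dualVec_self h.symm.lt, hw, mul_one] at h2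
  change ∑ i, |y i| ^ q ≤ 1
  rw [← hHq]
  exact Real.rpow_le_one hH.le h2 h.symm.pos.le

/-- The volume of a parallelepiped cut out by one linear functional and all but one of the
coordinates. -/
lemma volume_slab {n : ℕ} (i : Fin n) (w : Euc n) (hw : w i ≠ 0) (a b R : ℝ) :
    volume {u : Euc n | (a ≤ ⟪w, u⟫ ∧ ⟪w, u⟫ ≤ b) ∧ ∀ j, j ≠ i → |u j| ≤ R} =
      ENNReal.ofReal |w i|⁻¹ * (ENNReal.ofReal (b - a) * ENNReal.ofReal (2 * R) ^ (n - 1)) := by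
  classical
  set f : Module.Dual ℝ (Euc n) :=
    (innerSL ℝ (w - EuclideanSpace.single i 1)).toLinearMap with hf
  set T := LinearMap.transvection f (EuclideanSpace.single i (1 : ℝ)) with hT
  have hfu : ∀ u, f u = ⟪w, u⟫ - u i := by
    intro u
    simp [hf, EuclideanSpace.inner_single_left]
  have hdet : LinearMap.det T = w i := by
    rw [hT, LinearMap.transvection.det, hfu]
    simp [EuclideanSpace.inner_single_right]
  have hTi : ∀ u, T u i = ⟪w, u⟫ := by
    intro u; simp [hT, LinearMap.transvection.apply, hfu]
  have hTj : ∀ u j, j ≠ i → T u j = u j := by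
    intro u j hj; simp [hT, LinearMap.transvection.apply, hj]
  have hset : {u : Euc n | (a ≤ ⟪w, u⟫ ∧ ⟪w, u⟫ ≤ b) ∧ ∀ j, j ≠ i → |u j| ≤ R} =
      T ⁻¹' ((fun u : Euc n => (WithLp.ofLp u : Fin n → ℝ)) ⁻¹'
        (Set.Icc (Function.update (fun _ => -R) i a) (Function.update (fun _ => R) i b))) := by
    ext u
    simp only [mem_ofPred_eq, mem_preimage, mem_Icc, Pi.le_def]
    constructor
    · rintro ⟨⟨h1, h2⟩, h3⟩
      refine ⟨fun j => ?_, fun j => ?_⟩ <;> rcases eq_or_ne j i with rfl | hj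
      · simpa [hTi] using h1
      · simpa [hj, hTj _ _ hj] using (abs_le.mp (h3 j hj)).1
      · simpa [hTi] using h2
      · simpa [hj, hTj _ _ hj] using (abs_le.mp (h3 j hj)).2
    · rintro ⟨h1, h2⟩
      refine ⟨⟨by simpa [hTi] using h1 i, by simpa [hTi] using h2 i⟩, fun j hj => ?_⟩
      exact abs_le.mpr ⟨by simpa [hj, hTj _ _ hj] using h1 j, by simpa [hj, hTj _ _ hj] using h2 j⟩
  rw [hset, Measure.addHaar_preimage_linearMap _ (by rw [hdet]; exact hw), hdet, abs_inv,
    (PiLp.volume_preserving_ofLp (Fin n)).measure_preimage measurableSet_Icc.nullMeasurableSet,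
    Real.volume_Icc_pi, ← Finset.mul_prod_erase _ _ (Finset.mem_univ i)]
  congr 2
  · simp
  · rw [Finset.prod_congr rfl (g := fun _ => ENNReal.ofReal (2 * R))]
    · simp
    · intro j hj
      have : j ≠ i := Finset.ne_of_mem_erase hj
      simp [this, two_mul]

lemma volume_pi_sum_rpow_le {m : ℕ} {p : ℝ} (hp : 0 < p) {s : ℝ} (hs : 0 ≤ s) :
    volume {z : Fin m → ℝ | ∑ i, |z i| ^ p ≤ s} ≤
      ENNReal.ofReal (s ^ ((m : ℝ) / p)) * volume (lpBall m p) := by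
  have hB : volume (lpBall m p) = volume {z : Fin m → ℝ | ∑ i, |z i| ^ p ≤ 1} := by
    have hmeas : MeasurableSet {z : Fin m → ℝ | ∑ i, |z i| ^ p ≤ 1} := by
      refine (isClosed_le ?_ continuous_const).measurableSet
      exact continuous_finsetSum _ fun i _ =>
        Continuous.rpow_const (by fun_prop) fun _ => Or.inr hp.le
    rw [← (PiLp.volume_preserving_ofLp (Fin m)).measure_preimage hmeas.nullMeasurableSet]
    rfl
  have hsub : {z : Fin m → ℝ | ∑ i, |z i| ^ p ≤ s} ⊆
      (s ^ (1 / p)) • {z : Fin m → ℝ | ∑ i, |z i| ^ p ≤ 1} := by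
    intro z hz
    have hz' : ∑ i, |z i| ^ p ≤ s := hz
    have hsp : (s ^ (1 / p)) ^ p = s := by
      rw [← Real.rpow_mul hs]; field_simp; simp
    rcases hs.eq_or_lt with rfl | hs0
    · refine ⟨0, by simp [Real.zero_rpow hp.ne'], ?_⟩
      have h0 : ∀ i, z i = 0 := by
        intro i
        have h := Finset.single_le_sum (f := fun j => |z j| ^ p) (fun j _ => by positivity)
          (Finset.mem_univ i)
        have h2 : |z i| ^ p = 0 := le_antisymm (h.trans hz') (by positivity)
        simpa using (Real.rpow_eq_zero (abs_nonneg _) hp.ne').mp h2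
      ext i; simp [h0 i]
    · have hc : 0 < s ^ (1 / p) := Real.rpow_pos_of_pos hs0 _
      refine ⟨(s ^ (1 / p))⁻¹ • z, ?_, smul_inv_smul₀ hc.ne' z⟩
      change ∑ i, |((s ^ (1 / p))⁻¹ • z) i| ^ p ≤ 1
      have : ∀ i, |((s ^ (1 / p))⁻¹ • z) i| ^ p = s⁻¹ * |z i| ^ p := by
        intro i
        rw [Pi.smul_apply, smul_eq_mul, abs_mul, Real.mul_rpow (abs_nonneg _) (abs_nonneg _),
          abs_of_pos (inv_pos.mpr hc), Real.inv_rpow hc.le, hsp]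
      rw [Finset.sum_congr rfl fun i _ => this i, ← Finset.mul_sum, inv_mul_le_iff₀ hs0]
      linarith
  refine (measure_mono hsub).trans (le_of_eq ?_)
  rw [Measure.addHaar_smul, ← hB, Module.finrank_fin_fun, ← Real.rpow_natCast,
    ← Real.rpow_mul hs, abs_of_nonneg (by positivity)]
  congr 3
  ring

/-- The volume of the cap of `B_p` at a coordinate vector. -/
lemma volume_cap_le {m : ℕ} {p : ℝ} (hp : 1 < p) {h : ℝ} (h0 : 0 ≤ h) (h1 : h ≤ 1) :
    volume (lpBall (m + 1) p ∩ {y | 1 - h ≤ y 0}) ≤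
      ENNReal.ofReal (p ^ ((m : ℝ) / p) * (h ^ ((m : ℝ) / p + 1) / ((m : ℝ) / p + 1))) *
        volume (lpBall m p) := by
  have hp0 : 0 < p := by linarith
  set e : ℝ := (m : ℝ) / p with he
  have he0 : 0 ≤ e := by positivity
  set A : Set (ℝ × (Fin m → ℝ)) :=
    {y | |y.1| ^ p + ∑ i, |y.2 i| ^ p ≤ 1} ∩ {y | 1 - h ≤ y.1} with hA
  have hAm : MeasurableSet A := by
    refine IsClosed.measurableSet (IsClosed.inter (isClosed_le ?_ continuous_const)
      (isClosed_le continuous_const continuous_fst))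
    refine Continuous.add (Continuous.rpow_const (by fun_prop) fun _ => Or.inr hp0.le) ?_
    exact continuous_finsetSum _ fun i _ =>
      Continuous.rpow_const (by fun_prop) fun _ => Or.inr hp0.le
  have hpre : lpBall (m + 1) p ∩ {y | 1 - h ≤ y 0} =
      (fun u : Euc (m + 1) => (WithLp.ofLp u : Fin (m + 1) → ℝ)) ⁻¹'
        (MeasurableEquiv.piFinSuccAbove (fun _ => ℝ) 0 ⁻¹' A) := by
    ext y
    have e1 : y ∈ lpBall (m + 1) p ↔ |y 0| ^ p + ∑ i : Fin m, |y i.succ| ^ p ≤ 1 := by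
      rw [← Fin.sum_univ_succ (fun i => |y i| ^ p)]; rfl
    rw [mem_inter_iff, e1]
    rfl
  rw [hpre, (PiLp.volume_preserving_ofLp (Fin (m + 1))).measure_preimage
    ((MeasurableEquiv.measurable _) hAm).nullMeasurableSet,
    (volume_preserving_piFinSuccAbove (fun _ => ℝ) 0).measure_preimage hAm.nullMeasurableSet,
    Measure.volume_eq_prod, Measure.prod_apply hAm]
  have hfib : ∀ u : ℝ, volume (Prod.mk u ⁻¹' A) ≤ (Set.Icc (1 - h) 1).indicator
      (fun u => ENNReal.ofReal ((p * (1 - u)) ^ e) * volume (lpBall m p)) u := by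
    intro u
    by_cases hu : u ∈ Set.Icc (1 - h) 1
    · rw [Set.indicator_of_mem hu]
      have hu0 : 0 ≤ u := by linarith [hu.1]
      refine le_trans (measure_mono fun z hz => ?_)
        (volume_pi_sum_rpow_le hp0 (mul_nonneg hp0.le (sub_nonneg.mpr hu.2)))
      have hz' : |u| ^ p + ∑ i, |z i| ^ p ≤ 1 := hz.1
      have ht := rpow_tangent_le hp zero_le_one hu0
      rw [abs_of_nonneg hu0] at hz'
      simp only [Real.one_rpow] at ht
      change ∑ i, |z i| ^ p ≤ p * (1 - u)
      linarith
    · rw [Set.indicator_of_notMem hu, nonpos_iff_eq_zero]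
      convert measure_empty (μ := (volume : Measure (Fin m → ℝ)))
      ext z
      simp only [mem_preimage, mem_empty_iff_false, iff_false]
      rintro ⟨h2, h3⟩
      apply hu
      refine ⟨h3, ?_⟩
      by_contra! hc
      have h4 : 1 < |u| ^ p := Real.one_lt_rpow (lt_of_lt_of_le hc (le_abs_self u)) hp0
      have h5 : 0 ≤ ∑ i, |z i| ^ p := Finset.sum_nonneg fun i _ => by positivity
      have h6 : |u| ^ p + ∑ i, |z i| ^ p ≤ 1 := h2
      linarith
  refine (lintegral_mono hfib).trans (le_of_eq ?_)
  have hcont : Continuous fun u : ℝ => (p * (1 - u)) ^ e :=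
    Continuous.rpow_const (by fun_prop) fun _ => Or.inr he0
  rw [lintegral_indicator measurableSet_Icc, lintegral_mul_const _
    hcont.measurable.ennreal_ofReal, ← ofReal_integral_eq_lintegral_ofReal
    (hcont.integrableOn_Icc) ((ae_restrict_iff' measurableSet_Icc).mpr
      (Filter.Eventually.of_forall fun u hu =>
        Real.rpow_nonneg (mul_nonneg hp0.le (sub_nonneg.mpr hu.2)) _)),
    integral_Icc_eq_integral_Ioc, ← intervalIntegral.integral_of_le (by linarith)]
  congr 2
  have hc : ∀ u ∈ Set.uIcc (1 - h) 1, (p * (1 - u)) ^ e = p ^ e * (1 - u) ^ e := by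
    intro u hu
    rw [Set.uIcc_of_le (by linarith)] at hu
    exact Real.mul_rpow hp0.le (sub_nonneg.mpr hu.2)
  rw [intervalIntegral.integral_congr hc, intervalIntegral.integral_const_mul,
    intervalIntegral.integral_comp_sub_left (fun x => x ^ e) 1, integral_rpow (Or.inl (by linarith))]
  simp [Real.zero_rpow (by linarith : e + 1 ≠ 0)]

lemma exists_inv_le_abs {n : ℕ} {q : ℝ} (hq : 1 < q) {w : Euc n} (hw : ∑ i, |w i| ^ q = 1) :
    ∃ i, (n : ℝ)⁻¹ ≤ |w i| := by
  have hwm : w ∈ lpBall n q := hw.le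
  have hn : n ≠ 0 := by
    rintro rfl
    simp at hw
  have hn' : (n : ℝ) ≠ 0 := Nat.cast_ne_zero.mpr hn
  by_contra! hc
  have h1 : ∑ i, |w i| ^ q < ∑ _i : Fin n, (n : ℝ)⁻¹ := by
    have : Nonempty (Fin n) := ⟨⟨0, Nat.pos_of_ne_zero hn⟩⟩
    refine Finset.sum_lt_sum_of_nonempty Finset.univ_nonempty fun i _ => ?_
    refine lt_of_le_of_lt ?_ (hc i)
    have := Real.rpow_le_rpow_of_exponent_ge' (abs_nonneg (w i))
      (abs_le_one_of_mem_lpBall (by linarith) hwm i) zero_le_one hq.le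
    rwa [Real.rpow_one] at this
  simp [hw, hn'] at h1

/-- A lower bound for the volume of the caps of `B_p`, `1 < p < 2`. -/
lemma le_volume_cap {n : ℕ} {p q : ℝ} (hpq : p.HolderConjugate q) (hp2 : p < 2) {w : Euc n}
    (hw : ∑ i, |w i| ^ q = 1) {h R : ℝ} (h0 : 0 < h) (hR : h ≤ R)
    (hRp : 8 * (n * ((n : ℝ) ^ 2 * R) ^ p) ≤ h) :
    ENNReal.ofReal (h / 2 * (2 * R) ^ (n - 1)) ≤
      volume (lpBall n p ∩ {y | 1 - h ≤ ⟪w, y⟫}) := by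
  obtain ⟨i, hi⟩ := exists_inv_le_abs hpq.symm.lt hw
  have hn : 0 < n := Nat.pos_of_ne_zero fun h => by subst h; exact i.elim0
  have hn1 : (1 : ℝ) ≤ n := by exact_mod_cast hn
  have hwm : w ∈ lpBall n q := hw.le
  have hwle : ∀ j, |w j| ≤ 1 := abs_le_one_of_mem_lpBall hpq.symm.pos hwm
  have hwi : 0 < |w i| := lt_of_lt_of_le (by positivity) hi
  set x := dualVec q w with hx
  have hxw : dualVec p x = w := dualVec_dualVec hpq w
  have hxs : ∑ i, |x i| ^ p = 1 := by rw [hx, sum_dualVec_rpow hpq, hw]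
  have hwx : ⟪w, x⟫ = 1 := by
    rw [← hxw, inner_dualVec_self hpq.lt, hxs]
  have hR0 : 0 < R := lt_of_lt_of_le h0 hR
  set S := {u : Euc n | (-(3 * h / 4) ≤ ⟪w, u⟫ ∧ ⟪w, u⟫ ≤ -(h / 4)) ∧ ∀ j, j ≠ i → |u j| ≤ R}
    with hS
  have hvol : ENNReal.ofReal (h / 2 * (2 * R) ^ (n - 1)) ≤ volume S := by
    rw [hS, volume_slab i w (abs_pos.mp hwi), ENNReal.ofReal_mul (by positivity),
      ENNReal.ofReal_pow (by positivity)]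
    have e : -(h / 4) - -(3 * h / 4) = h / 2 := by ring
    rw [e]
    refine le_mul_of_one_le_left (by positivity) ?_
    rw [ENNReal.one_le_ofReal]
    exact (one_le_inv₀ hwi).mpr (hwle i)
  rw [← measure_preimage_add_right volume (-x) S] at hvol
  refine hvol.trans (measure_mono fun y hy => ?_)
  obtain ⟨⟨hy1, hy2⟩, hy3⟩ : y + -x ∈ S := hy
  set u := y + -x with hu
  have hyu : y = x + u := by rw [hu]; abel
  have hub : ∀ j, |u j| ≤ (n : ℝ) ^ 2 * R := by
    intro j
    rcases eq_or_ne j i with rfl | hj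
    · have h1 : w j * u j = ⟪w, u⟫ - ∑ k ∈ Finset.univ.erase j, w k * u k := by
        rw [inner_eq_sum, ← Finset.add_sum_erase _ _ (Finset.mem_univ j)]; ring
      have h2 : |∑ k ∈ Finset.univ.erase j, w k * u k| ≤ (n - 1) * R := by
        calc _ ≤ ∑ k ∈ Finset.univ.erase j, |w k * u k| := Finset.abs_sum_le_sum_abs _ _
          _ ≤ ∑ k ∈ Finset.univ.erase j, R := by
              refine Finset.sum_le_sum fun k hk => ?_
              rw [abs_mul]
              calc |w k| * |u k| ≤ 1 * R := mul_le_mul (hwle k)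
                    (hy3 k (Finset.ne_of_mem_erase hk)) (abs_nonneg _) zero_le_one
                _ = R := one_mul R
          _ = (n - 1) * R := by simp [Nat.cast_sub hn]
      have h3 : |w j| * |u j| ≤ n * R := by
        rw [← abs_mul, h1]
        have h4 : |⟪w, u⟫| ≤ R := by rw [abs_le]; constructor <;> linarith
        calc _ ≤ |⟪w, u⟫| + |∑ k ∈ Finset.univ.erase j, w k * u k| := abs_sub _ _
          _ ≤ n * R := by linarith
      have h5 : (n : ℝ)⁻¹ * |u j| ≤ n * R := (by gcongr : _ ≤ |w j| * |u j|).trans h3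
      rw [inv_mul_le_iff₀ (by positivity)] at h5
      linarith [h5]
    · refine (hy3 j hj).trans ?_
      exact le_mul_of_one_le_left hR0.le (one_le_pow₀ hn1)
  refine ⟨?_, ?_⟩
  · change ∑ j, |y j| ^ p ≤ 1
    have h1 : ∀ j, |y j| ^ p ≤ |x j| ^ p + p * (w j * u j) + 2 * p * ((n : ℝ) ^ 2 * R) ^ p := by
      intro j
      have h2 := abs_add_rpow_le hpq.lt hp2 (x j) (u j)
      have h3 : signedPow p (x j) = w j := by rw [← hxw]; rfl
      have h4 : |u j| ^ p ≤ ((n : ℝ) ^ 2 * R) ^ p :=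
        Real.rpow_le_rpow (abs_nonneg _) (hub j) hpq.pos.le
      rw [h3] at h2
      have h5 : y j = x j + u j := by rw [hyu]; rfl
      rw [h5]
      have := hpq.pos
      nlinarith
    calc _ ≤ ∑ j, (|x j| ^ p + p * (w j * u j) + 2 * p * ((n : ℝ) ^ 2 * R) ^ p) :=
          Finset.sum_le_sum fun j _ => h1 j
      _ = 1 + p * ⟪w, u⟫ + p / 4 * (8 * (n * ((n : ℝ) ^ 2 * R) ^ p)) := by
          rw [Finset.sum_add_distrib, Finset.sum_add_distrib, hxs, ← Finset.mul_sum,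
            ← inner_eq_sum]
          simp; ring
      _ ≤ 1 := by
          have := hpq.pos
          nlinarith
  · change 1 - h ≤ ⟪w, y⟫
    rw [hyu, inner_add_right, hwx]
    linarith

/-- A lower bound for the volume of the caps of `B_q` at the coordinate vectors. -/
lemma le_volume_cap_coord {n : ℕ} {q : ℝ} (hq : 1 < q) (i : Fin n) {s R : ℝ} (h0 : 0 < s)
    (h1 : s ≤ 1) (hR : 0 ≤ R) (hRq : n * R ^ q ≤ s / 2) :
    ENNReal.ofReal (s / 2 * (2 * R) ^ (n - 1)) ≤ volume (lpBall n q ∩ {y | 1 - s ≤ y i}) := by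
  have hv := volume_slab i (EuclideanSpace.single i (1 : ℝ)) (by simp) (1 - s) (1 - s / 2) R
  have e : 1 - s / 2 - (1 - s) = s / 2 := by ring
  rw [e] at hv
  simp only [EuclideanSpace.inner_single_left, PiLp.single_apply, if_true, abs_one, inv_one,
    ENNReal.ofReal_one, one_mul, map_one] at hv
  rw [ENNReal.ofReal_mul (by positivity), ENNReal.ofReal_pow (by positivity), ← hv]
  refine measure_mono ?_
  rintro y ⟨⟨hy1, hy2⟩, hy3⟩
  refine ⟨?_, hy1⟩
  change ∑ j, |y j| ^ q ≤ 1
  have hyi : |y i| ^ q ≤ 1 - s / 2 := by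
    have hy0 : 0 ≤ y i := by linarith
    rw [abs_of_nonneg hy0]
    have := Real.rpow_le_rpow_of_exponent_ge' hy0 (by linarith) zero_le_one hq.le
    rw [Real.rpow_one] at this
    linarith
  rw [← Finset.add_sum_erase _ _ (Finset.mem_univ i)]
  have h2 : ∑ j ∈ Finset.univ.erase i, |y j| ^ q ≤ n * R ^ q := by
    calc _ ≤ ∑ j ∈ Finset.univ.erase i, R ^ q := Finset.sum_le_sum fun j hj =>
          Real.rpow_le_rpow (abs_nonneg _) (hy3 j (Finset.ne_of_mem_erase hj)) (by linarith)
      _ ≤ ∑ j : Fin n, R ^ q := Finset.sum_le_sum_of_subset_of_nonneg (Finset.erase_subset _ _)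
          fun _ _ _ => by positivity
      _ = n * R ^ q := by simp
  linarith

/-- Convex combinations of `x` with a part of `K` which lie outside `K` bound the volume of
that part in terms of the parameter of any illumination body containing `x`. -/
lemma volume_le_of_mem_illuminationBody {n : ℕ} {K S : Set (Euc n)} (hKm : MeasurableSet K)
    (hKf : volume K ≠ ⊤) (hSK : S ⊆ K) {δ θ : ℝ} (hδ : 0 ≤ δ) (hθ0 : 0 ≤ θ) (hθ1 : θ ≤ 1)
    {x k : Euc n} (hx : x ∈ illuminationBody K δ) (hk : ∀ y ∈ K, ⟪k, y⟫ ≤ 1)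
    (hS : ∀ y ∈ S, 1 < (1 - θ) * ⟪k, x⟫ + θ * ⟪k, y⟫) :
    ENNReal.ofReal (θ ^ n) * volume S ≤ ENNReal.ofReal δ * volume K := by
  have hx' : volume (convexHull ℝ (K ∪ {x})) ≤ ENNReal.ofReal (1 + δ) * volume K := hx
  set U : Set (Euc n) := (fun y => (1 - θ) • x + y) '' (θ • S) with hU
  have hUv : volume U = ENNReal.ofReal (θ ^ n) * volume S := by
    rw [hU, image_add_left, measure_preimage_add, Measure.addHaar_smul, finrank_euclideanSpace,
      Fintype.card_fin, abs_of_nonneg (by positivity)]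
  have hUK : Disjoint K U := by
    rw [Set.disjoint_left]
    rintro z hzK ⟨_, ⟨y, hy, rfl⟩, rfl⟩
    have h1 := hk _ hzK
    have h2 := hS y hy
    simp only [inner_add_right, inner_smul_right] at h1
    linarith
  have hsub : K ∪ U ⊆ convexHull ℝ (K ∪ {x}) := by
    rintro z (hz | ⟨_, ⟨y, hy, rfl⟩, rfl⟩)
    · exact subset_convexHull ℝ _ (Or.inl hz)
    · have hcv := convex_convexHull ℝ (K ∪ {x})
      exact hcv (subset_convexHull ℝ _ (Or.inr rfl))
        (subset_convexHull ℝ _ (Or.inl (hSK hy))) (by linarith) hθ0 (by ring)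
  have h3 := (measure_mono hsub).trans hx'
  rw [measure_union' hUK hKm, hUv, ENNReal.ofReal_add zero_le_one hδ, add_mul,
    ENNReal.ofReal_one, one_mul] at h3
  exact (ENNReal.add_le_add_iff_left hKf).mp h3

/-- Every illumination body is bounded. -/
lemma inner_le_of_mem_illuminationBody {n : ℕ} {K : Set (Euc n)} (hK0 : (0 : Euc n) ∈ K)
    (hKp : volume K ≠ 0) (hKf : volume K ≠ ⊤) {δ : ℝ} (hδ : 0 ≤ δ) {x k : Euc n}
    (hx : x ∈ illuminationBody K δ) (hk : ∀ y ∈ K, |⟪k, y⟫| ≤ 1) :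
    ⟪k, x⟫ ≤ 2 * (2 ^ n * (1 + δ)) := by
  rcases le_or_gt ⟪k, x⟫ 0 with hx0 | hx0
  · exact hx0.trans (by positivity)
  have hx' : volume (convexHull ℝ (K ∪ {x})) ≤ ENNReal.ofReal (1 + δ) * volume K := hx
  set f : Module.Dual ℝ (Euc n) := (innerSL ℝ ((1 / 2 : ℝ) • k)).toLinearMap with hf
  have hfu : ∀ u, f u = 1 / 2 * ⟪k, u⟫ := by
    intro u
    change ⟪(1 / 2 : ℝ) • k, u⟫ = _
    rw [inner_smul_left]; simp
  set T := LinearMap.transvection f x with hT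
  have hdet : LinearMap.det T = 1 + 1 / 2 * ⟪k, x⟫ := by
    rw [hT, LinearMap.transvection.det, hfu]
  set U : Set (Euc n) := (fun y => (1 / 4 : ℝ) • x + y) '' ((1 / 2 : ℝ) • (T '' K)) with hU
  have hUv : volume U = ENNReal.ofReal ((1 / 2) ^ n * (1 + 1 / 2 * ⟪k, x⟫)) * volume K := by
    rw [hU, image_add_left, measure_preimage_add, Measure.addHaar_smul, finrank_euclideanSpace,
      Fintype.card_fin, abs_of_nonneg (by positivity), Measure.addHaar_image_linearMap, hdet,
      abs_of_pos (by positivity), ← mul_assoc, ← ENNReal.ofReal_mul (by positivity)]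
  have hsub : U ⊆ convexHull ℝ (K ∪ {x}) := by
    rintro _ ⟨_, ⟨_, ⟨y, hy, rfl⟩, rfl⟩, rfl⟩
    obtain ⟨h1, h2⟩ := abs_le.mp (hk y hy)
    have hc : (1 / 4 : ℝ) • x + (1 / 2 : ℝ) • T y = (1 / 2 : ℝ) • y +
        (1 / 2 : ℝ) • ((1 / 2 + 1 / 2 * ⟪k, y⟫) • x
          + (1 / 2 - 1 / 2 * ⟪k, y⟫) • (0 : Euc n)) := by
      rw [hT, LinearMap.transvection.apply, hfu]
      module
    change (1 / 4 : ℝ) • x + (1 / 2 : ℝ) • T y ∈ _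
    rw [hc]
    have hcv := convex_convexHull ℝ (K ∪ {x})
    exact hcv (subset_convexHull ℝ _ (Or.inl hy)) (hcv (subset_convexHull ℝ _ (Or.inr rfl))
      (subset_convexHull ℝ _ (Or.inl hK0)) (by linarith) (by linarith) (by ring))
      (by norm_num) (by norm_num) (by norm_num)
  have h3 := (measure_mono hsub).trans hx'
  rw [hUv, ENNReal.mul_le_mul_iff_left hKp hKf,
    ENNReal.ofReal_le_ofReal_iff (by linarith)] at h3
  have h4 : (2 : ℝ) ^ n * ((1 / 2) ^ n * (1 + 1 / 2 * ⟪k, x⟫)) ≤ 2 ^ n * (1 + δ) := by gcongr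
  rw [← mul_assoc, ← mul_pow] at h4
  norm_num at h4
  linarith

/-- A point of `conv (B_q ∪ {x})` outside `B_q` is visible from `x`: its supporting functional is
at least as large at `x`. -/
lemma sum_le_inner_of_mem_convexHull {n : ℕ} {q : ℝ} (hq : 1 < q) {x z : Euc n}
    (hz : z ∈ convexHull ℝ (lpBall n q ∪ {x})) (hzB : z ∉ lpBall n q) :
    ∑ i, |z i| ^ q ≤ ⟪dualVec q z, x⟫ := by
  have h1 : 1 < ∑ i, |z i| ^ q := lt_of_not_ge hzB
  by_contra! hc
  have hsub : lpBall n q ∪ {x} ⊆ {y | ⟪dualVec q z, y⟫ < ∑ i, |z i| ^ q} := by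
    rintro y (hy | rfl)
    · have h2 := inner_dualVec_le hq z y
      have hy' : ∑ i, |y i| ^ q ≤ 1 := hy
      have h3 : 1 / q * ∑ i, |y i| ^ q < 1 / q * ∑ i, |z i| ^ q :=
        mul_lt_mul_of_pos_left (by linarith) (by positivity)
      change ⟪dualVec q z, y⟫ < _
      linarith
    · exact hc
  have hconv : Convex ℝ {y : Euc n | ⟪dualVec q z, y⟫ < ∑ i, |z i| ^ q} :=
    convex_halfSpace_lt (innerSL ℝ (dualVec q z)).toLinearMap.isLinear _
  have h4 : ⟪dualVec q z, z⟫ < ∑ i, |z i| ^ q := convexHull_min hsub hconv hz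
  rw [inner_dualVec_self hq] at h4
  exact lt_irrefl _ h4

/-- The diagonal point `n^{-1/q} (1, …, 1)` of the `ℓ_q` unit sphere. -/
def diagPt (n : ℕ) (q : ℝ) : Euc n := WithLp.toLp 2 fun _ => (n : ℝ) ^ (-(1 / q))

@[simp] lemma diagPt_apply (n : ℕ) (q : ℝ) (i : Fin n) : diagPt n q i = (n : ℝ) ^ (-(1 / q)) := rfl

lemma diagPt_rpow {n : ℕ} {q : ℝ} (hq : 0 < q) : ((n : ℝ) ^ (-(1 / q))) ^ q = (n : ℝ)⁻¹ := by
  rw [← Real.rpow_mul (by positivity)]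
  have : -(1 / q) * q = -1 := by field_simp
  rw [this, Real.rpow_neg_one]

lemma sum_diagPt {n : ℕ} (hn : 0 < n) {q : ℝ} (hq : 0 < q) :
    ∑ i, |diagPt n q i| ^ q = 1 := by
  have hn' : (n : ℝ) ≠ 0 := Nat.cast_ne_zero.mpr hn.ne'
  have h : ∀ i, |diagPt n q i| ^ q = (n : ℝ)⁻¹ := fun i => by
    rw [diagPt_apply, abs_of_nonneg (by positivity), diagPt_rpow hq]
  simp [-diagPt_apply, h, hn']

lemma mul_signedPow {q k : ℝ} (hk : 0 < k) (s : ℝ) :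
    signedPow q (k * s) = k ^ (q - 1) * signedPow q s := by
  unfold signedPow
  rw [abs_mul, abs_of_pos hk, Real.mul_rpow hk.le (abs_nonneg _)]
  have : k ^ (q - 1) = k ^ (q - 2) * k := by rw [← Real.rpow_add_one hk.ne']; ring_nf
  rw [this]; ring

set_option maxHeartbeats 1000000 in
/-- Upper bound for the volume gained by adding to `B_q`, `q > 2`, a point outside it close to the
diagonal point. -/
lemma exists_volume_convexHull_le {n : ℕ} (hn : 0 < n) {q : ℝ} (hq : 2 < q) :
    ∃ C t₀ : ℝ, 0 < C ∧ 0 < t₀ ∧ ∀ t : ℝ, 0 < t → t ≤ t₀ →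
      volume (convexHull ℝ (lpBall n q ∪ {(1 + t) • diagPt n q})) ≤
        volume (lpBall n q) + ENNReal.ofReal (C * (t * √t ^ (n - 1))) := by
  obtain ⟨c, hc, hdef⟩ := exists_young_deficit hq
  have hq0 : 0 < q := by linarith
  have hq1 : 1 < q := by linarith
  have hn0 : (0 : ℝ) < n := by exact_mod_cast hn
  set k : ℝ := (n : ℝ) ^ (-(1 / q)) with hk
  have hk0 : 0 < k := by positivity
  have hkq : k ^ q = (n : ℝ)⁻¹ := diagPt_rpow hq0
  have hkq1 : k ^ (q - 1) * k = (n : ℝ)⁻¹ := by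
    rw [← Real.rpow_add_one hk0.ne', sub_add_cancel, hkq]
  set M : ℝ := 4 * n / c with hM
  have hM0 : 0 < M := by positivity
  set L : ℝ := q * ((q - 1) * 2 ^ (q - 2)) with hL
  have hL0 : 0 < L := by
    have : 0 < q - 1 := by linarith
    positivity
  set C2 : ℝ := L * M / (n * q) with hC2
  have hC20 : 0 < C2 := by positivity
  have hkq0 : 0 < k ^ (q - 1) := by positivity
  refine ⟨(k ^ (q - 1))⁻¹ * ((1 + C2) * (2 * (k * √M)) ^ (n - 1)),
    min (1 / (2 * q)) (1 / M), by positivity, by positivity, fun t ht htt => ?_⟩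
  have ht1 : t ≤ 1 / (2 * q) := htt.trans (min_le_left _ _)
  have ht2 : t * M ≤ 1 := by
    have := htt.trans (min_le_right _ _)
    rwa [le_div_iff₀ hM0] at this
  have ht3 : t * (2 * q) ≤ 1 := by rwa [le_div_iff₀ (by positivity)] at ht1
  have htl : 0 ≤ 1 - t := by linarith [mul_le_mul_of_nonneg_left hq1.le ht.le]
  set x₀ := diagPt n q with hx₀
  set w := dualVec q x₀ with hw
  have hwi : ∀ i, w i = k ^ (q - 1) := fun i => by
    rw [hw, dualVec_apply, hx₀, diagPt_apply, ← hk, signedPow_of_nonneg hq1 hk0.le]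
  have hwx : ⟪w, x₀⟫ = 1 := by rw [hw, inner_dualVec_self hq1, hx₀, sum_diagPt hn hq0]
  let i₀ : Fin n := ⟨0, hn⟩
  set S := {u : Euc n | (-(C2 * t) ≤ ⟪w, u⟫ ∧ ⟪w, u⟫ ≤ t) ∧ ∀ j, j ≠ i₀ → |u j| ≤ k * √(M * t)}
    with hS
  have hSv : volume S ≤ ENNReal.ofReal ((k ^ (q - 1))⁻¹ * ((1 + C2) * (2 * (k * √M)) ^ (n - 1)) *
      (t * √t ^ (n - 1))) := by
    rw [hS, volume_slab i₀ w (by rw [hwi]; exact hkq0.ne'), hwi, abs_of_pos hkq0,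
      ← ENNReal.ofReal_pow (by positivity), ← ENNReal.ofReal_mul (by nlinarith),
      ← ENNReal.ofReal_mul (by positivity)]
    apply le_of_eq
    congr 1
    rw [Real.sqrt_mul hM0.le, show 2 * (k * (√M * √t)) = 2 * (k * √M) * √t by ring, mul_pow]
    ring
  have hsub : convexHull ℝ (lpBall n q ∪ {(1 + t) • x₀}) ⊆
      lpBall n q ∪ (fun y => y + -x₀) ⁻¹' S := by
    intro z hz
    by_cases hzB : z ∈ lpBall n q
    · exact Or.inl hzB
    right
    have hF1 : 1 < ∑ i, |z i| ^ q := lt_of_not_ge hzB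
    have hvis := sum_le_inner_of_mem_convexHull hq1 hz hzB
    set F := ∑ i, |z i| ^ q with hF
    rw [inner_smul_right] at hvis
    have hyg := inner_dualVec_le hq1 z x₀
    rw [← hF, hx₀, sum_diagPt hn hq0, ← hx₀] at hyg
    have hF4 : F ≤ 4 := by
      have h1 : F ≤ (1 + t) * ((1 - 1 / q) * F + 1 / q * 1) :=
        hvis.trans (mul_le_mul_of_nonneg_left hyg (by linarith))
      have h2 : q * F ≤ (1 + t) * ((q - 1) * F + 1) := by
        have h3 := mul_le_mul_of_nonneg_left h1 hq0.le
        have h4 : q * ((1 + t) * ((1 - 1 / q) * F + 1 / q * 1)) = (1 + t) * ((q - 1) * F + 1) := by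
          field_simp
        rwa [h4] at h3
      nlinarith
    have hwz : ⟪w, z⟫ ≤ 1 + t := by
      have hconv : Convex ℝ {y : Euc n | ⟪w, y⟫ ≤ 1 + t} :=
        convex_halfSpace_le (innerSL ℝ w).toLinearMap.isLinear _
      refine convexHull_min ?_ hconv hz
      rintro y (hy | rfl)
      · have h2 := inner_dualVec_le hq1 x₀ y
        have hy' : ∑ i, |y i| ^ q ≤ 1 := hy
        rw [← hw, hx₀, sum_diagPt hn hq0] at h2
        have h3 : 1 / q * ∑ i, |y i| ^ q ≤ 1 / q * 1 := by gcongr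
        change ⟪w, y⟫ ≤ 1 + t
        linarith
      · change ⟪w, (1 + t) • x₀⟫ ≤ 1 + t
        rw [inner_smul_right, hwx, mul_one]
    have hzs : ∀ i, z i = k * (z i / k) := fun i => by field_simp
    have hpow : ∀ i, |z i / k| ^ q = n * |z i| ^ q := fun i => by
      rw [abs_div, abs_of_pos hk0, Real.div_rpow (abs_nonneg _) hk0.le, hkq]
      field_simp
    have hsp : ∀ i, signedPow q (z i / k) = n * (signedPow q (z i) * k) := fun i => by
      conv_rhs => rw [hzs i, mul_signedPow hk0]
      have : (n : ℝ) * (k ^ (q - 1) * k) = 1 := by rw [hkq1]; field_simp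
      linear_combination -(signedPow q (z i / k)) * this
    have hin : ⟪dualVec q z, x₀⟫ = ∑ i, signedPow q (z i) * k := by
      rw [inner_eq_sum]; rfl
    have hsq : ∑ i, (z i / k - 1) ^ 2 ≤ M * t := by
      have h1 : ∑ i, c * (z i / k - 1) ^ 2 ≤
          ∑ i, (1 / q + (1 - 1 / q) * (n * |z i| ^ q) - n * (signedPow q (z i) * k)) := by
        refine Finset.sum_le_sum fun i _ => ?_
        rw [← hpow, ← hsp]
        exact hdef _
      have h2 : ∑ i, (1 / q + (1 - 1 / q) * (n * |z i| ^ q) - n * (signedPow q (z i) * k)) =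
          n * (1 / q + (1 - 1 / q) * F - ⟪dualVec q z, x₀⟫) := by
        rw [Finset.sum_sub_distrib, Finset.sum_add_distrib, ← Finset.mul_sum, ← Finset.mul_sum,
          ← Finset.mul_sum, ← hin, ← hF]
        simp; ring
      have h3 : 1 / q + (1 - 1 / q) * F - ⟪dualVec q z, x₀⟫ ≤ 4 * t := by
        have h6 : 0 ≤ ⟪dualVec q z, x₀⟫ := by
          by_contra! h7
          linarith [mul_neg_of_pos_of_neg (by linarith : 0 < 1 + t) h7]
        have h4 : (1 - t) * F ≤ ⟪dualVec q z, x₀⟫ := by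
          have h5 := mul_le_mul_of_nonneg_left hvis htl
          linarith [mul_nonneg (sq_nonneg t) h6]
        have h8 : 1 / q * (1 - F) ≤ 0 := mul_nonpos_of_nonneg_of_nonpos (by positivity) (by linarith)
        linarith [mul_le_mul_of_nonneg_left hF4 ht.le]
      rw [← Finset.mul_sum, h2] at h1
      have h9 := h1.trans (mul_le_mul_of_nonneg_left h3 hn0.le)
      rw [hM, div_mul_eq_mul_div, le_div_iff₀ hc]
      linarith
    have hsqi : ∀ i, (z i / k - 1) ^ 2 ≤ M * t := fun i =>
      (Finset.single_le_sum (f := fun i => (z i / k - 1) ^ 2) (fun j _ => sq_nonneg _)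
        (Finset.mem_univ i)).trans hsq
    have habs : ∀ i, |z i / k - 1| ≤ √(M * t) := fun i => Real.abs_le_sqrt (hsqi i)
    have habs1 : ∀ i, |z i / k - 1| ≤ 1 := fun i => by
      rw [← sq_le_one_iff_abs_le_one]
      linarith [hsqi i]
    have hwz' : ⟪w, z⟫ = (n : ℝ)⁻¹ * ∑ i, z i / k := by
      rw [inner_eq_sum, Finset.mul_sum]
      refine Finset.sum_congr rfl fun i _ => ?_
      rw [hwi, ← hkq1]
      field_simp
    have hlow : -(C2 * t) ≤ ⟪w, z⟫ - 1 := by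
      have h1 : ∑ i, (n * |z i| ^ q) ≤ ∑ i, (1 + q * (z i / k - 1) + L * (z i / k - 1) ^ 2) := by
        refine Finset.sum_le_sum fun i _ => ?_
        rw [← hpow]
        exact rpow_le_one_add_sq hq (habs1 i)
      have h2 : ∑ i, (1 + q * (z i / k - 1) + L * (z i / k - 1) ^ 2) =
          n + q * (n * ⟪w, z⟫ - n) + L * ∑ i, (z i / k - 1) ^ 2 := by
        rw [Finset.sum_add_distrib, Finset.sum_add_distrib, ← Finset.mul_sum, ← Finset.mul_sum,
          Finset.sum_sub_distrib, hwz']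
        simp only [Finset.sum_const, Finset.card_univ, Fintype.card_fin, nsmul_eq_mul]
        field_simp
      rw [← Finset.mul_sum, h2, ← hF] at h1
      have h3 : L * ∑ i, (z i / k - 1) ^ 2 ≤ L * (M * t) := by gcongr
      have h4 : (n : ℝ) * 1 < n * F := by gcongr
      have h5 : L * (M * t) = n * q * (C2 * t) := by rw [hC2]; field_simp
      have h6 : 0 < (n * q) * (⟪w, z⟫ - 1 + C2 * t) := by nlinarith
      have h7 := pos_of_mul_pos_right h6 (by positivity)
      linarith
    have hu : ⟪w, z + -x₀⟫ = ⟪w, z⟫ - 1 := by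
      rw [inner_add_right, inner_neg_right, hwx]; ring
    refine ⟨⟨by rw [hu]; exact hlow, by rw [hu]; linarith⟩, fun j _ => ?_⟩
    have h1 : (z + -x₀) j = k * (z j / k - 1) := by
      have : (z + -x₀) j = z j - k := by rw [PiLp.add_apply, PiLp.neg_apply, hx₀, diagPt_apply]; ring
      rw [this]; field_simp
    rw [h1, abs_mul, abs_of_pos hk0]
    exact mul_le_mul_of_nonneg_left (habs j) hk0.le
  refine (measure_mono hsub).trans ((measure_union_le _ _).trans ?_)
  rw [measure_preimage_add_right]
  gcongr

lemma polarBody_anti {n : ℕ} {K L : Set (Euc n)} (h : K ⊆ L) : polarBody L ⊆ polarBody K :=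
  fun _ hy x hx => hy x (h hx)

lemma subset_illuminationBody {n : ℕ} {K : Set (Euc n)} (hK : Convex ℝ K) {δ : ℝ} (hδ : 0 ≤ δ) :
    K ⊆ illuminationBody K δ := by
  intro x hx
  have h : K ∪ {x} = K := union_eq_self_of_subset_right (singleton_subset_iff.mpr hx)
  change volume (convexHull ℝ (K ∪ {x})) ≤ _
  rw [h, hK.convexHull_eq]
  calc volume K = 1 * volume K := (one_mul _).symm
    _ ≤ _ := by
      gcongr
      exact ENNReal.one_le_ofReal.mpr (by linarith)

lemma floatingBody_lpBall_subset {n : ℕ} {p q : ℝ} (hpq : p.HolderConjugate q) (δ : ℝ) :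
    floatingBody (lpBall n p) δ ⊆ lpBall n p := by
  intro x hx
  rw [← polarBody_lpBall hpq.symm]
  intro v hv
  rcases eq_or_ne v 0 with rfl | hv0
  · simp
  refine le_of_forall_gt_imp_ge_of_dense fun c hc => ?_
  have hemp : lpBall n p ∩ {y | c ≤ ⟪v, y⟫} = ∅ := by
    ext y
    simp only [mem_inter_iff, mem_empty_iff_false, iff_false, not_and]
    intro hy hcy
    have h1 : c ≤ ⟪v, y⟫ := hcy
    exact absurd (inner_le_one hpq.symm hv hy) (by linarith)
  have hx' := mem_iInter.mp (mem_iInter.mp (mem_iInter.mp (mem_iInter.mp hx v) hv0) c)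
    (by rw [hemp, measure_empty]; exact zero_le)
  exact hx'

lemma floatingBody_lpBall_coord_le {m : ℕ} {p : ℝ} (hp : 1 < p) {δ h : ℝ} (hδ : 0 ≤ δ)
    (h0 : 0 ≤ h) (h1 : h ≤ 1)
    (hle : p ^ ((m : ℝ) / p) * (h ^ ((m : ℝ) / p + 1) / ((m : ℝ) / p + 1)) *
      (volume (lpBall m p)).toReal ≤ δ * (volume (lpBall (m + 1) p)).toReal)
    {y : Euc (m + 1)} (hy : y ∈ floatingBody (lpBall (m + 1) p) δ) : y 0 ≤ 1 - h := by
  have hp0 : 0 < p := by linarith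
  have hv0 : EuclideanSpace.single (0 : Fin (m + 1)) (1 : ℝ) ≠ 0 := by
    intro h
    simpa using congrArg (fun v : Euc (m + 1) => v 0) h
  have hvol : volume (lpBall (m + 1) p ∩
      {y | 1 - h ≤ ⟪EuclideanSpace.single (0 : Fin (m + 1)) (1 : ℝ), y⟫}) ≤
      ENNReal.ofReal δ * volume (lpBall (m + 1) p) := by
    simp only [EuclideanSpace.inner_single_left, map_one, one_mul]
    refine (volume_cap_le hp h0 h1).trans ?_
    rw [← ENNReal.ofReal_toReal (volume_lpBall_ne_top (n := m) hp0),
      ← ENNReal.ofReal_toReal (volume_lpBall_ne_top (n := m + 1) hp0),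
      ← ENNReal.ofReal_mul (by positivity), ← ENNReal.ofReal_mul hδ]
    exact ENNReal.ofReal_le_ofReal hle
  have h2 := mem_iInter.mp (mem_iInter.mp (mem_iInter.mp (mem_iInter.mp hy _) hv0) _) hvol
  have h3 : ⟪EuclideanSpace.single (0 : Fin (m + 1)) (1 : ℝ), y⟫ ≤ 1 - h := h2
  simpa [EuclideanSpace.inner_single_left] using h3

lemma smul_mem_lpBall {n : ℕ} {p : ℝ} (hp : 1 < p) {y : Euc n} (hy : y ∈ lpBall n p) {r : ℝ}
    (h0 : 0 ≤ r) (h1 : r ≤ 1) : r • y ∈ lpBall n p := by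
  have hc : Convex ℝ (lpBall n p) := convex_lpBall hp
  exact hc.smul_mem_of_zero_mem (zero_mem_lpBall (by linarith)) hy ⟨h0, h1⟩

lemma abs_inner_le_one {n : ℕ} {p q : ℝ} (hpq : p.HolderConjugate q) {x y : Euc n}
    (hx : x ∈ lpBall n p) (hy : y ∈ lpBall n q) : |⟪x, y⟫| ≤ 1 := by
  have h1 := inner_le_one hpq hx hy
  have h2 := inner_le_one hpq (neg_mem_lpBall hx) hy
  rw [inner_neg_left] at h2
  exact abs_le.mpr ⟨by linarith, h1⟩

lemma bodyDist_admissible {n : ℕ} {p q : ℝ} (hpq : p.HolderConjugate q) {F : Set (Euc n)}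
    (hF : F ⊆ lpBall n p) {r : ℝ} (hr : 0 < r) (hrF : ∀ y ∈ lpBall n p, r • y ∈ F) {δ g a : ℝ}
    (hδ : 0 ≤ δ) (hg : ∀ k ∈ lpBall n p, ∀ x ∈ illuminationBody (lpBall n q) δ, ⟪k, x⟫ ≤ g)
    (ha : 0 < a) (hga : g ≤ a) (har : 1 ≤ a * r) :
    a⁻¹ • F ⊆ polarBody (illuminationBody (lpBall n q) δ) ∧
      polarBody (illuminationBody (lpBall n q) δ) ⊆ a • F := by
  constructor
  · rintro _ ⟨y, hy, rfl⟩ x hx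
    change ⟪x, a⁻¹ • y⟫ ≤ 1
    rw [inner_smul_right, real_inner_comm, inv_mul_le_iff₀ ha, mul_one]
    exact (hg y (hF hy) x hx).trans hga
  · intro x hx
    have hxK : x ∈ lpBall n p := by
      rw [← polarBody_lpBall hpq.symm]
      exact polarBody_anti (subset_illuminationBody (convex_lpBall hpq.symm.lt) hδ) hx
    have h1 : (a * r)⁻¹ • x ∈ lpBall n p :=
      smul_mem_lpBall hpq.lt hxK (by positivity) (inv_le_one_of_one_le₀ har)
    refine ⟨r • (a * r)⁻¹ • x, hrF _ h1, ?_⟩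
    change a • r • (a * r)⁻¹ • x = x
    rw [smul_smul, smul_smul, mul_inv_cancel₀ (by positivity), one_smul]

lemma eventually_smul_mem_floatingBody {n : ℕ} (hn : 0 < n) {p q : ℝ} (hpq : p.HolderConjugate q)
    (hp2 : p < 2) : ∃ B : ℝ, 0 < B ∧ ∀ᶠ δ in 𝓝[>] (0 : ℝ),
      ∀ y ∈ lpBall n p, (1 - B * δ ^ (p / ((n : ℝ) - 1 + p))) • y ∈ floatingBody (lpBall n p) δ := by
  have hp0 : 0 < p := hpq.pos
  have hn1 : (1 : ℝ) ≤ n := by exact_mod_cast hn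
  set α : ℝ := p / ((n : ℝ) - 1 + p) with hα
  have hα0 : 0 < α := div_pos hp0 (by linarith)
  set V := (volume (lpBall n p)).toReal with hV
  have hV0 : 0 ≤ V := ENNReal.toReal_nonneg
  set ρ : ℝ := (8 * (n * ((n : ℝ) ^ 2) ^ p))⁻¹ ^ (1 / p) with hρ
  have hρ0 : 0 < ρ := by positivity
  have hρp : ρ ^ p = (8 * (n * ((n : ℝ) ^ 2) ^ p))⁻¹ := by
    rw [hρ, ← Real.rpow_mul (by positivity), one_div_mul_cancel hp0.ne', Real.rpow_one]
  set c₀ : ℝ := 1 / 2 * (2 * ρ) ^ (n - 1) with hc₀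
  have hc₀0 : 0 < c₀ := by positivity
  set A : ℝ := (V + 1) / c₀ with hA
  have hA0 : 0 < A := by positivity
  refine ⟨A ^ α, by positivity, ?_⟩
  have hlim : Tendsto (fun δ : ℝ => (A * δ) ^ α) (𝓝[>] 0) (𝓝 0) := by
    have h1 : ContinuousAt (fun δ : ℝ => (A * δ) ^ α) 0 :=
      ((continuous_const.mul continuous_id).continuousAt).rpow_const (Or.inr hα0.le)
    have h2 := h1.tendsto
    rw [mul_zero, Real.zero_rpow hα0.ne'] at h2
    exact h2.mono_left nhdsWithin_le_nhds
  have hlim2 : Tendsto (fun δ : ℝ => ((A * δ) ^ α) ^ (1 - 1 / p)) (𝓝[>] 0) (𝓝 0) := by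
    have h3 : 0 < 1 - 1 / p := by
      have : 1 / p < 1 := by rw [div_lt_one hp0]; exact hpq.lt
      linarith
    have h1 := hlim.rpow_const (p := 1 - 1 / p) (Or.inr h3.le)
    rwa [Real.zero_rpow h3.ne'] at h1
  filter_upwards [hlim2.eventually (eventually_lt_nhds hρ0),
    hlim.eventually (eventually_lt_nhds one_pos), self_mem_nhdsWithin] with δ hδρ hδ1 hδ y hy
  have hδ0 : 0 < δ := hδ
  rw [← Real.mul_rpow hA0.le hδ0.le]
  set h : ℝ := (A * δ) ^ α with hh
  have h0 : 0 < h := by positivity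
  refine mem_iInter.mpr fun v => mem_iInter.mpr fun hv => mem_iInter.mpr fun c =>
    mem_iInter.mpr fun hvol => ?_
  change ⟪v, (1 - h) • y⟫ ≤ c
  by_contra! hc
  obtain ⟨H, w, hH, rfl, hw, -⟩ := exists_normalize hpq.symm.pos hv
  have hwy : ⟪w, y⟫ ≤ 1 := inner_le_one hpq.symm hw.le hy
  have hR : h ≤ ρ * h ^ (1 / p) := by
    calc h = h ^ (1 - 1 / p) * h ^ (1 / p) := by
          rw [← Real.rpow_add h0, sub_add_cancel, Real.rpow_one]
      _ ≤ _ := by gcongr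
  have hRp : 8 * (n * ((n : ℝ) ^ 2 * (ρ * h ^ (1 / p))) ^ p) ≤ h := by
    apply le_of_eq
    rw [Real.mul_rpow (by positivity) (by positivity), Real.mul_rpow (by positivity) (by positivity),
      hρp, ← Real.rpow_mul h0.le, one_div_mul_cancel hp0.ne', Real.rpow_one]
    field_simp
  have hcap := le_volume_cap hpq hp2 hw h0 hR hRp
  have hexp : h / 2 * (2 * (ρ * h ^ (1 / p))) ^ (n - 1) = c₀ * (A * δ) := by
    have e1 : h * (h ^ (1 / p)) ^ (n - 1) = A * δ := by
      rw [← Real.rpow_natCast, ← Real.rpow_mul h0.le, ← Real.rpow_one_add' h0.le (by positivity), hh,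
        ← Real.rpow_mul (by positivity)]
      have e2 : α * (1 + 1 / p * ((n - 1 : ℕ) : ℝ)) = 1 := by
        have e3 : (n : ℝ) - 1 + p ≠ 0 := by linarith
        rw [Nat.cast_sub hn, Nat.cast_one, hα]
        field_simp
        ring
      rw [e2, Real.rpow_one]
    rw [← e1, hc₀, ← mul_assoc 2, mul_pow]
    ring
  have hcA : c₀ * (A * δ) = (V + 1) * δ := by rw [hA]; field_simp
  rw [hexp, hcA] at hcap
  have hcap2 : lpBall n p ∩ {y | 1 - h ≤ ⟪w, y⟫} ⊆ lpBall n p ∩ {y | c ≤ ⟪H • w, y⟫} := by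
    rintro z ⟨hz, hz2⟩
    refine ⟨hz, ?_⟩
    have hz2' : 1 - h ≤ ⟪w, z⟫ := hz2
    change c ≤ ⟪H • w, z⟫
    rw [inner_smul_left, inner_smul_right] at hc
    rw [inner_smul_left]
    simp only [conj_trivial] at hc ⊢
    have h5 : H * ((1 - h) * ⟪w, y⟫) ≤ H * ⟪w, z⟫ := by
      refine mul_le_mul_of_nonneg_left ?_ hH.le
      exact (mul_le_of_le_one_right (by linarith) hwy).trans hz2'
    linarith
  have hfin := hcap.trans ((measure_mono hcap2).trans hvol)
  rw [← ENNReal.ofReal_toReal (volume_lpBall_ne_top (n := n) hp0), ← ENNReal.ofReal_mul hδ0.le,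
    ENNReal.ofReal_le_ofReal_iff (by positivity), ← hV] at hfin
  linarith

lemma eventually_mem_illuminationBody {n : ℕ} (hn : 0 < n) {q : ℝ} (hq : 2 < q) {b : ℝ}
    (hb : 0 < b) : ∃ C : ℝ, 0 < C ∧ ∀ᶠ τ in 𝓝[>] (0 : ℝ), ∀ δ : ℝ, 0 ≤ δ →
      C * (τ * √τ ^ (n - 1)) ≤ δ * (volume (lpBall n q)).toReal →
      (1 + b * τ) • diagPt n q ∈ illuminationBody (lpBall n q) δ := by
  obtain ⟨C, t₀, hC, ht₀, hvol⟩ := exists_volume_convexHull_le hn hq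
  refine ⟨C * (b * √b ^ (n - 1)), by positivity, ?_⟩
  filter_upwards [Ioo_mem_nhdsGT (div_pos ht₀ hb)] with τ ⟨hτ0, hτ1⟩ δ hδ hle
  change volume (convexHull ℝ (lpBall n q ∪ {(1 + b * τ) • diagPt n q})) ≤ _
  have h1 : b * τ ≤ t₀ := by
    rw [lt_div_iff₀ hb] at hτ1
    linarith
  refine (hvol (b * τ) (by positivity) h1).trans ?_
  rw [← ENNReal.ofReal_toReal (volume_lpBall_ne_top (n := n) (p := q) (by linarith)),
    ← ENNReal.ofReal_mul (by linarith), ← ENNReal.ofReal_add (by positivity) (by positivity)]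
  refine ENNReal.ofReal_le_ofReal ?_
  rw [Real.sqrt_mul hb.le, mul_pow]
  linarith

lemma eventually_coord_le_of_mem_illuminationBody {n : ℕ} (hn : 2 ≤ n) {q : ℝ} (hq : 2 < q)
    {η C : ℝ} (hη : 0 < η) : ∀ᶠ τ in 𝓝[>] (0 : ℝ), ∀ δ : ℝ, 0 ≤ δ →
      δ * (volume (lpBall n q)).toReal < C * (τ * √τ ^ (n - 1)) →
      ∀ x ∈ illuminationBody (lpBall n q) δ, ∀ i, x i ≤ 1 + η * τ := by
  have hq0 : 0 < q := by linarith
  have hn0 : (0 : ℝ) < n := by exact_mod_cast (by omega : 0 < n)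
  set κ : ℝ := (1 / 2) ^ n * (η / 2 * (2 * (η / (2 * n)) ^ (1 / q)) ^ (n - 1)) with hκ
  have hκ0 : 0 < κ := by positivity
  have hexp : 0 < 1 / 2 - 1 / q := by
    have := one_div_lt_one_div_of_lt two_pos hq
    linarith
  have hlim : Tendsto (fun τ : ℝ => C * (τ ^ (1 / 2 - 1 / q)) ^ (n - 1)) (𝓝[>] 0) (𝓝 0) := by
    have h1 : ContinuousAt (fun τ : ℝ => C * (τ ^ (1 / 2 - 1 / q)) ^ (n - 1)) 0 :=
      continuousAt_const.mul ((continuousAt_id.rpow_const (Or.inr hexp.le)).pow _)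
    have h2 := h1.tendsto
    rw [Real.zero_rpow hexp.ne', zero_pow (by omega), mul_zero] at h2
    exact h2.mono_left nhdsWithin_le_nhds
  filter_upwards [hlim.eventually (eventually_lt_nhds hκ0), Ioo_mem_nhdsGT (one_div_pos.mpr hη)]
    with τ hτκ ⟨hτ0, hτ1⟩ δ hδ hlt x hx i
  by_contra! hxi
  have hs1 : η * τ ≤ 1 := by
    rw [lt_div_iff₀ hη] at hτ1
    linarith
  set R : ℝ := (η * τ / (2 * n)) ^ (1 / q) with hR
  have hRq : n * R ^ q ≤ η * τ / 2 := by
    apply le_of_eq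
    rw [hR, ← Real.rpow_mul (by positivity), one_div_mul_cancel hq0.ne', Real.rpow_one]
    field_simp
  have hcap := le_volume_cap_coord (by linarith : 1 < q) i (by positivity : 0 < η * τ) hs1
    (by positivity) hRq
  have hk : ∀ y : Euc n, ⟪EuclideanSpace.single i (1 : ℝ), y⟫ = y i := fun y => by
    simp [EuclideanSpace.inner_single_left]
  have hill := volume_le_of_mem_illuminationBody (S := lpBall n q ∩ {y | 1 - η * τ ≤ y i})
    (θ := 1 / 2) (isClosed_lpBall hq0.le).measurableSet
    (volume_lpBall_ne_top hq0) inter_subset_left hδ (by norm_num) (by norm_num) hx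
    (k := EuclideanSpace.single i (1 : ℝ))
    (fun y hy => by rw [hk]; exact (abs_le.mp (abs_le_one_of_mem_lpBall hq0 hy i)).2)
    (fun y hy => by
      have hy2 : 1 - η * τ ≤ y i := hy.2
      rw [hk, hk]
      linarith)
  have hfin := (mul_le_mul_right hcap _).trans hill
  rw [← ENNReal.ofReal_toReal (volume_lpBall_ne_top (n := n) hq0), ← ENNReal.ofReal_mul hδ,
    ← ENNReal.ofReal_mul (by positivity), ENNReal.ofReal_le_ofReal_iff (by positivity)] at hfin
  have e1 : (1 / 2) ^ n * (η * τ / 2 * (2 * R) ^ (n - 1)) = τ * (τ ^ (1 / q)) ^ (n - 1) * κ := by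
    rw [hR, hκ, mul_div_right_comm η, mul_div_right_comm η, Real.mul_rpow (by positivity) hτ0.le, ← mul_assoc 2, mul_pow]
    ring
  have e2 : C * (τ * √τ ^ (n - 1)) =
      τ * (τ ^ (1 / q)) ^ (n - 1) * (C * (τ ^ (1 / 2 - 1 / q)) ^ (n - 1)) := by
    have : √τ = τ ^ (1 / 2 - 1 / q) * τ ^ (1 / q) := by
      rw [← Real.rpow_add hτ0, sub_add_cancel, Real.sqrt_eq_rpow]
    rw [this, mul_pow]
    ring
  rw [e1] at hfin
  rw [e2] at hlt
  have h3 := mul_lt_mul_of_pos_left hτκ (by positivity : 0 < τ * (τ ^ (1 / q)) ^ (n - 1))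
  linarith

lemma eventually_le_of_admissible {n : ℕ} (hn : 2 ≤ n) {p q : ℝ} (hpq : p.HolderConjugate q)
    (hp2 : p < 2) {B c η : ℝ} (hB : 0 < B) (hc : 0 < c) (hη : 0 < η) (i : Fin n) :
    ∀ᶠ τ in 𝓝[>] (0 : ℝ), ∀ F : Set (Euc n), (∀ y ∈ lpBall n p, (1 - B * τ) • y ∈ F) →
      (∀ y ∈ F, y i ≤ 1 - c * τ) → ∀ δ : ℝ, 0 ≤ δ → ∀ a : ℝ, 1 ≤ a →
      a⁻¹ • F ⊆ polarBody (illuminationBody (lpBall n q) δ) →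
      polarBody (illuminationBody (lpBall n q) δ) ⊆ a • F → 1 + (c - η) * τ ≤ a := by
  have hq2 : 2 < q := by
    rw [hpq.conjugate_eq, lt_div_iff₀ (by linarith [hpq.lt])]
    linarith
  have hq0 : 0 < q := by linarith
  set b : ℝ := B + c + 1 with hb
  obtain ⟨C, -, hev⟩ := eventually_mem_illuminationBody (by omega : 0 < n) hq2
    (by positivity : 0 < b)
  filter_upwards [hev, eventually_coord_le_of_mem_illuminationBody hn hq2 hη,
    Ioo_mem_nhdsGT (by positivity : 0 < 1 / (B * b))]
    with τ hvis hcoord ⟨hτ0, hτ1⟩ F hBF hcF δ hδ a ha h1 h2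
  have ha0 : 0 < a := by linarith
  rw [lt_div_iff₀ (by positivity)] at hτ1
  by_contra! hlt
  have hsmall : δ * (volume (lpBall n q)).toReal < C * (τ * √τ ^ (n - 1)) := by
    by_contra! hge
    have h3 := hvis δ hδ hge
    have hsum : ∑ i, |diagPt n q i| ^ q = 1 := sum_diagPt (by omega) hq0
    have h4 : dualVec q (diagPt n q) ∈ lpBall n p := by
      change ∑ i, |dualVec q (diagPt n q) i| ^ p ≤ 1
      rw [sum_dualVec_rpow hpq, hsum]
    have h5 : ⟪(1 + b * τ) • diagPt n q, a⁻¹ • (1 - B * τ) • dualVec q (diagPt n q)⟫ ≤ 1 :=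
      h1 (smul_mem_smul_set (hBF _ h4)) _ h3
    rw [inner_smul_left, inner_smul_right, inner_smul_right, real_inner_comm,
      inner_dualVec_self (by linarith : 1 < q), hsum, mul_one, conj_trivial,
      mul_left_comm, inv_mul_le_iff₀ ha0, mul_one] at h5
    have h6 : τ * (τ * (B * b)) < τ * 1 := mul_lt_mul_of_pos_left hτ1 hτ0
    have h7 : 0 < η * τ := by positivity
    have h8 : (1 + b * τ) * (1 - B * τ) = 1 + c * τ + τ - τ * (τ * (B * b)) := by rw [hb]; ring
    linarith
  have h9 : (1 + η * τ)⁻¹ • EuclideanSpace.single i (1 : ℝ) ∈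
      polarBody (illuminationBody (lpBall n q) δ) := by
    intro x hx
    have h10 := hcoord δ hδ hsmall x hx i
    have h11 : ⟪x, EuclideanSpace.single i (1 : ℝ)⟫ = x i := by
      simp [EuclideanSpace.inner_single_right]
    rw [inner_smul_right, h11, inv_mul_le_iff₀ (by positivity), mul_one]
    exact h10
  obtain ⟨y, hy, hay⟩ := h2 h9
  have h12 : a * y i = (1 + η * τ)⁻¹ := by
    have := congrArg (fun v : Euc n => v i) hay
    simpa using this
  have h13 : (1 + η * τ)⁻¹ ≤ a * (1 - c * τ) := by
    rw [← h12]
    exact mul_le_mul_of_nonneg_left (hcF y hy) ha0.le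
  have hητ : 0 < η * τ := by positivity
  have hcτ : 0 < c * τ := by positivity
  rw [inv_le_iff_one_le_mul₀ (by positivity)] at h13
  have h14 : 0 < 1 - c * τ := by
    by_contra! h15
    have := mul_nonpos_of_nonneg_of_nonpos ha0.le h15
    linarith [mul_nonpos_of_nonpos_of_nonneg this (by positivity : 0 ≤ 1 + η * τ)]
  have h16 : a * (1 - c * τ) * (1 + η * τ) ≤ (1 + (c - η) * τ) * (1 - c * τ) * (1 + η * τ) := by
    gcongr
  have h17 : (1 + (c - η) * τ) * (1 - c * τ) * (1 + η * τ) =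
      1 - ((c - η) * τ) ^ 2 - (1 + (c - η) * τ) * ((c * τ) * (η * τ)) := by ring
  have h18 : 0 < (1 + (c - η) * τ) * ((c * τ) * (η * τ)) :=
    mul_pos (by linarith) (by positivity)
  linarith [sq_nonneg ((c - η) * τ)]

lemma eventually_exists_admissible {n : ℕ} {p q : ℝ} (hpq : p.HolderConjugate q)
    {B : ℝ} (hB : 0 < B) :
    ∀ᶠ τ in 𝓝[>] (0 : ℝ), ∀ F ⊆ lpBall n p, (∀ y ∈ lpBall n p, (1 - B * τ) • y ∈ F) →
      ∃ δ : ℝ, 0 < δ ∧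
        (1 + (2 * B + 1) * τ)⁻¹ • F ⊆ polarBody (illuminationBody (lpBall n q) δ) ∧
        polarBody (illuminationBody (lpBall n q) δ) ⊆ (1 + (2 * B + 1) * τ) • F := by
  have hq0 : 0 < q := hpq.symm.pos
  filter_upwards [Ioo_mem_nhdsGT one_pos, Ioo_mem_nhdsGT (by positivity : 0 < 1 / (2 * B + 1))]
    with τ ⟨hτ0, hτ1⟩ ⟨_, hτ2⟩ F hFK hBF
  rw [lt_div_iff₀ (by positivity)] at hτ2
  refine ⟨(τ / 4) ^ n / 2, by positivity, ?_⟩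
  have h1 : B * τ < 1 := by linarith
  refine bodyDist_admissible hpq hFK (r := 1 - B * τ) (by linarith) hBF (g := 1 + τ)
    (by positivity) ?_ (by positivity) (by nlinarith) ?_
  · intro k hk x hx
    by_contra! hlt
    have h2 := volume_le_of_mem_illuminationBody (θ := τ / 4) (S := lpBall n q) (k := k)
      (isClosed_lpBall hq0.le).measurableSet (volume_lpBall_ne_top hq0) subset_rfl
      (by positivity) (by positivity) (by linarith) hx (fun y hy => inner_le_one hpq hk hy)
      (fun y hy => by
        have h3 := (abs_le.mp (abs_inner_le_one hpq hk hy)).1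
        have h4 := mul_lt_mul_of_pos_left hlt (by linarith : 0 < 1 - τ / 4)
        have h5 := mul_le_mul_of_nonneg_left h3 (by positivity : 0 ≤ τ / 4)
        nlinarith)
    have hV0 := (volume_lpBall_pos (n := n) hq0)
    rw [ENNReal.mul_le_mul_iff_left hV0.ne' (volume_lpBall_ne_top hq0),
      ENNReal.ofReal_le_ofReal_iff (by positivity)] at h2
    linarith [pow_pos (by positivity : 0 < τ / 4) n]
  · have h6 : B * τ * (τ * (2 * B + 1)) ≤ B * τ * 1 :=
      mul_le_mul_of_nonneg_left hτ2.le (by positivity)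
    linarith [mul_pos hB hτ0]

lemma rpow_cap_constant {m : ℕ} {p δ V v c : ℝ} (hp : 1 < p) (hδ : 0 < δ) (hV : 0 < V) (hv : 0 < v)
    (hc : c = ((m : ℝ) + p) ^ (p / ((m : ℝ) + p)) / p * (V / v) ^ (p / ((m : ℝ) + p))) :
    p ^ ((m : ℝ) / p) * ((c * δ ^ (p / ((m : ℝ) + p))) ^ ((m : ℝ) / p + 1) / ((m : ℝ) / p + 1)) * v
      = δ * V := by
  have hp0 : 0 < p := by linarith
  have hmp : 0 < (m : ℝ) + p := by positivity
  have e : p / ((m : ℝ) + p) * ((m : ℝ) / p + 1) = 1 := by field_simp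
  have hroot : ∀ x : ℝ, 0 ≤ x → (x ^ (p / ((m : ℝ) + p))) ^ ((m : ℝ) / p + 1) = x := fun x hx => by
    rw [← Real.rpow_mul hx, e, Real.rpow_one]
  rw [hc, Real.mul_rpow (by positivity) (by positivity), Real.mul_rpow (by positivity) (by positivity),
    Real.div_rpow (by positivity) hp0.le, hroot _ hmp.le, hroot _ (by positivity), hroot _ hδ.le,
    Real.rpow_add_one hp0.ne']
  field_simp

lemma bodyDist_le {n : ℕ} {C₁ C₂ : Set (Euc n)} {a : ℝ} (ha : 1 ≤ a) (h1 : a⁻¹ • C₁ ⊆ C₂)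
    (h2 : C₂ ⊆ a • C₁) : bodyDist C₁ C₂ ≤ a :=
  csInf_le ⟨1, fun _ h => h.1⟩ ⟨ha, h1, h2⟩

lemma dualDist_le_bodyDist {n : ℕ} (C : Set (Euc n)) (δ : ℝ) {δ' : ℝ} (h : 0 < δ') :
    dualDist C δ ≤ bodyDist (floatingBody C δ)
      (polarBody (illuminationBody (polarBody C) δ')) := by
  refine csInf_le ⟨0, ?_⟩ ⟨δ', h, rfl⟩
  rintro _ ⟨_, _, rfl⟩
  exact Real.sInf_nonneg fun a ha => zero_le_one.trans ha.1

/-- Proposition 4.11: for `n ≥ 2` and `1 < p < 2`,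
`liminf_{δ→0} (d_p(δ) − 1)/δ^{p/(n−1+p)} ≥ c₁`, where
`c₁ = ((n−1+p)^{p/(n−1+p)}/p)·(|B_p^n|ₙ/|B_p^{n−1}|_{n−1})^{p/(n−1+p)}`. -/
theorem statement19 {n : ℕ} (hn : 2 ≤ n) (p : ℝ) (hp1 : 1 < p) (hp2 : p < 2) :
    ((n:ℝ) - 1 + p) ^ (p/((n:ℝ) - 1 + p)) / p *
        ((volume (lpBall n p)).toReal / (volume (lpBall (n-1) p)).toReal)
          ^ (p/((n:ℝ) - 1 + p))
      ≤ liminf (fun δ : ℝ => (dualDist (lpBall n p) δ - 1) / δ ^ (p/((n:ℝ) - 1 + p)))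
          (𝓝[>] 0) := by
  have hp0 : 0 < p := by linarith
  have hpq : p.HolderConjugate (p / (p - 1)) := Real.HolderConjugate.conjExponent hp1
  set q := p / (p - 1) with hq
  obtain ⟨m, rfl⟩ : ∃ m, n = m + 1 := ⟨n - 1, by omega⟩
  have hcast : ((m + 1 : ℕ) : ℝ) - 1 = m := by push_cast; ring
  obtain ⟨B, hB, hBev⟩ := eventually_smul_mem_floatingBody (by omega : 0 < m + 1) hpq hp2
  rw [Nat.add_sub_cancel]
  simp only [hcast] at hBev ⊢
  have hV : 0 < (volume (lpBall (m + 1) p)).toReal :=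
    ENNReal.toReal_pos (volume_lpBall_pos hp0).ne' (volume_lpBall_ne_top hp0)
  have hv : 0 < (volume (lpBall m p)).toReal :=
    ENNReal.toReal_pos (volume_lpBall_pos hp0).ne' (volume_lpBall_ne_top hp0)
  set c : ℝ := ((m : ℝ) + p) ^ (p / ((m : ℝ) + p)) / p *
    ((volume (lpBall (m + 1) p)).toReal / (volume (lpBall m p)).toReal) ^ (p / ((m : ℝ) + p))
    with hc
  have hc0 : 0 < c := by positivity
  set α : ℝ := p / ((m : ℝ) + p) with hα
  have hα0 : 0 < α := by positivity
  have hτ : Tendsto (fun δ : ℝ => δ ^ α) (𝓝[>] 0) (𝓝[>] 0) := by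
    refine tendsto_nhdsWithin_iff.mpr ⟨?_, ?_⟩
    · have h1 : ContinuousAt (fun δ : ℝ => δ ^ α) 0 := continuousAt_id.rpow_const (Or.inr hα0.le)
      have h2 := h1.tendsto
      rw [Real.zero_rpow hα0.ne'] at h2
      exact h2.mono_left nhdsWithin_le_nhds
    · filter_upwards [self_mem_nhdsWithin] with δ hδ
      exact Real.rpow_pos_of_pos hδ _
  have hsmall : ∀ b : ℝ, 0 < b → ∀ᶠ δ in 𝓝[>] (0 : ℝ), δ ^ α * b < 1 := fun b hb => by
    filter_upwards [hτ.eventually (Ioo_mem_nhdsGT (one_div_pos.mpr hb))] with δ hδ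
    rw [← lt_div_iff₀ hb]
    exact hδ.2
  have hupper : ∀ᶠ δ in 𝓝[>] (0 : ℝ),
      (dualDist (lpBall (m + 1) p) δ - 1) / δ ^ α ≤ 2 * B + 1 := by
    filter_upwards [hBev, hτ.eventually (eventually_exists_admissible hpq hB),
      self_mem_nhdsWithin] with δ hBδ hadm hδ
    have hδ0 : 0 < δ := hδ
    have hτ0 : 0 < δ ^ α := by positivity
    obtain ⟨δ', hδ', h1, h2⟩ := hadm _ (floatingBody_lpBall_subset hpq δ) hBδ
    rw [← polarBody_lpBall hpq] at h1 h2
    have h3 := (dualDist_le_bodyDist (lpBall (m + 1) p) δ hδ').trans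
      (bodyDist_le (by linarith [mul_pos (by positivity : 0 < 2 * B + 1) hτ0]) h1 h2)
    rw [div_le_iff₀ hτ0]
    linarith
  have hlower : ∀ η : ℝ, 0 < η → ∀ᶠ δ in 𝓝[>] (0 : ℝ),
      c - η ≤ (dualDist (lpBall (m + 1) p) δ - 1) / δ ^ α := fun η hη => by
    filter_upwards [hBev, hτ.eventually (eventually_le_of_admissible hn hpq hp2 hB hc0 hη 0),
      hsmall c hc0, hsmall B hB, self_mem_nhdsWithin] with δ hBδ hadm hcδ hB1 hδ
    have hδ0 : 0 < δ := hδ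
    have hτ0 : 0 < δ ^ α := by positivity
    have hcoord : ∀ y ∈ floatingBody (lpBall (m + 1) p) δ, y 0 ≤ 1 - c * δ ^ α := fun y hy =>
      floatingBody_lpBall_coord_le hp1 hδ0.le (by positivity) (by linarith)
        (rpow_cap_constant hp1 hδ0 hV hv hc).le hy
    have hFK := floatingBody_lpBall_subset (n := m + 1) hpq δ
    rw [le_div_iff₀ hτ0, le_sub_iff_add_le']
    refine le_csInf ⟨_, 1, one_pos, rfl⟩ ?_
    rintro _ ⟨δ', hδ', rfl⟩
    rw [polarBody_lpBall hpq]
    refine le_csInf ?_ fun a ha => hadm _ hBδ hcoord δ' hδ'.le a ha.1 ha.2.1 ha.2.2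
    set g : ℝ := 2 * (2 ^ (m + 1) * (1 + δ')) with hg
    have hg1 : 1 ≤ g := by
      have h1 : (1 : ℝ) ≤ 2 ^ (m + 1) := one_le_pow₀ one_le_two
      have h2 : (1 : ℝ) ≤ 2 ^ (m + 1) * (1 + δ') := one_le_mul_of_one_le_of_one_le h1 (by linarith)
      linarith
    have hr : 0 < 1 - B * δ ^ α := by linarith
    have hr1 : 1 - B * δ ^ α ≤ 1 := by linarith [mul_pos hB hτ0]
    have hga : g ≤ g / (1 - B * δ ^ α) := le_div_self (by linarith) hr hr1
    refine ⟨g / (1 - B * δ ^ α), hg1.trans hga, bodyDist_admissible hpq hFK hr hBδ hδ'.le ?_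
      (by linarith) hga (by rwa [div_mul_cancel₀ _ hr.ne'])⟩
    intro k hk x hx
    exact inner_le_of_mem_illuminationBody (zero_mem_lpBall hpq.symm.pos)
      (volume_lpBall_pos hpq.symm.pos).ne' (volume_lpBall_ne_top hpq.symm.pos) hδ'.le hx
      fun y hy => abs_inner_le_one hpq hk hy
  refine le_of_forall_sub_le fun η hη => ?_
  refine le_liminf_of_le ?_ (hlower η hη)
  exact IsCoboundedUnder.of_frequently_le hupper.frequently
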